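/- Key estimate for the boundary case (Section 4): Let Ω ⊂ ℝⁿ be a bounded open set and A a continuous map from the closure of Ω to symmetric positive definite n×n matrices. Assume there are a point x₀ ∈ ∂Ω, constants C₀ > 0, σ > 2s(n−2s)/(n−4s) and r₀ > 0 such that A(x) ≤ A(x₀) + C₀ |x − x₀|^σ I_n in the sense of bilinear forms for all x in the closure of Ω with |x − x₀| < r₀, and that ∂Ω is α-singular at x₀ for some α with 1 ≤ α < σ(n−4s)/(2s(n−2s)). If n > 4s, then for every λ > 0 one has the strict inequality S_λ^A < c_s · det(A(x₀))^{s/n} · K_s(n)⁻¹. -/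

import Mathlib

open MeasureTheory Filter Set Topology

noncomputable section

abbrev Euc (n : ℕ) := EuclideanSpace ℝ (Fin n)

/-- Partial derivative of `w` in the `i`-th horizontal direction. -/
noncomputable def pdX (n : ℕ) (w : Euc n → ℝ → ℝ) (i : Fin n) (x : Euc n) (y : ℝ) : ℝ :=
  fderiv ℝ (fun x' => w x' y) x (EuclideanSpace.single i 1)

/-- Partial derivative of `w` in the vertical direction. -/
noncomputable def pdY (n : ℕ) (w : Euc n → ℝ → ℝ) (x : Euc n) (y : ℝ) : ℝ :=
  deriv (fun y' => w x y') y

/-- `(∇ₓ w)ᵀ M (∇ₓ w)`. -/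
noncomputable def quadA (n : ℕ) (M : Matrix (Fin n) (Fin n) ℝ) (w : Euc n → ℝ → ℝ)
    (x : Euc n) (y : ℝ) : ℝ :=
  ∑ i, ∑ j, M i j * pdX n w i x y * pdX n w j x y

/-- `(∇ w)ᵀ diag(M,1) (∇ w)`. -/
noncomputable def quadB (n : ℕ) (M : Matrix (Fin n) (Fin n) ℝ) (w : Euc n → ℝ → ℝ)
    (x : Euc n) (y : ℝ) : ℝ :=
  quadA n M w x y + (pdY n w x y) ^ 2

/-- The set of Rayleigh quotients over smooth test functions compactly supported in
`Ω × [0,∞)` with nontrivial trace; `S_λ^A` is its infimum. -/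
noncomputable def SQuotSet (n : ℕ) (s cs lam : ℝ) (Ω : Set (Euc n))
    (A : Euc n → Matrix (Fin n) (Fin n) ℝ) : Set ℝ :=
  { r | ∃ f : Euc n → ℝ → ℝ,
      ContDiff ℝ (⊤ : ℕ∞) (fun p : Euc n × ℝ => f p.1 p.2) ∧
      IsCompact (closure {p : Euc n × ℝ | 0 ≤ p.2 ∧ f p.1 p.2 ≠ 0}) ∧
      closure {p : Euc n × ℝ | 0 ≤ p.2 ∧ f p.1 p.2 ≠ 0} ⊆ Ω ×ˢ Ici (0:ℝ) ∧
      (∃ x, f x 0 ≠ 0) ∧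
      r = (cs * (∫ x in Ω, ∫ y in Ioi (0:ℝ), y ^ (1 - 2*s) * quadB n (A x) f x y)
              - lam * (∫ x in Ω, (f x 0) ^ 2))
            / (∫ x in Ω, |f x 0| ^ (2*(n:ℝ) / ((n:ℝ) - 2*s))) ^ (((n:ℝ) - 2*s) / (n:ℝ)) }

/-- The set of Rayleigh quotients defining the best trace constant; `K_s(n)⁻¹` is its
infimum. -/
noncomputable def KQuotSet (n : ℕ) (s : ℝ) : Set ℝ :=
  { r | ∃ g : Euc n → ℝ → ℝ,
      ContDiff ℝ (⊤ : ℕ∞) (fun p : Euc n × ℝ => g p.1 p.2) ∧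
      IsCompact (closure {p : Euc n × ℝ | 0 ≤ p.2 ∧ g p.1 p.2 ≠ 0}) ∧
      (∃ x, g x 0 ≠ 0) ∧
      r = (∫ x : Euc n, ∫ y in Ioi (0:ℝ),
              y ^ (1 - 2*s) * ((∑ i, (pdX n g i x y) ^ 2) + (pdY n g x y) ^ 2))
            / (∫ x : Euc n, |g x 0| ^ (2*(n:ℝ) / ((n:ℝ) - 2*s))) ^ (((n:ℝ) - 2*s) / (n:ℝ)) }

/-- The boundary of `Ω` is `α`-singular at `x₀`. -/
def AlphaSingular (n : ℕ) (Ω : Set (Euc n)) (x₀ : Euc n) (α : ℝ) : Prop :=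
  ∃ δ > (0:ℝ), ∃ xs : ℕ → Euc n, (∀ j, xs j ∈ Ω) ∧
    Tendsto xs atTop (nhds x₀) ∧
    ∀ j, Metric.ball (xs j) (δ * ‖xs j - x₀‖ ^ α) ⊆ Ω

/-- Half-line measure with a power density. -/
def wt (s : ℝ) : Measure ℝ :=
  (volume.restrict (Ioi (0:ℝ))).withDensity (fun y => ENNReal.ofReal (y ^ (1 - 2*s)))

/-- The weighted half-space measure. -/
def mu (n : ℕ) (s : ℝ) : Measure (Euc n × ℝ) := (volume : Measure (Euc n)).prod (wt s)

/-- squared gradient -/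
def gsq (n : ℕ) (u : Euc n × ℝ → ℝ) (X : Euc n × ℝ) : ℝ :=
  (∑ i, (fderiv ℝ u X (EuclideanSpace.single i 1, 0)) ^ 2) + (fderiv ℝ u X (0, 1)) ^ 2

/-- weighted energy -/
def En (n : ℕ) (s : ℝ) (u : Euc n × ℝ → ℝ) : ℝ := ∫ X, gsq n u X ∂(mu n s)

/-- test functions -/
def Tst (n : ℕ) (u : Euc n × ℝ → ℝ) : Prop := ContDiff ℝ (⊤ : ℕ∞) u ∧ HasCompactSupport u

lemma meas_w (s : ℝ) : Measurable (fun y : ℝ => y ^ (1 - 2*s)) := by fun_prop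

lemma wt_Iic_lt_top {s : ℝ} (hs : s ∈ Ioo (0:ℝ) 1) (R : ℝ) : wt s (Iic R) < ⊤ := by
  rw [wt, withDensity_apply _ measurableSet_Iic, Measure.restrict_restrict measurableSet_Iic]
  have h : IntegrableOn (fun y : ℝ => y ^ (1 - 2*s)) (Iic R ∩ Ioi 0) := by
    have h1 : IntegrableOn (fun y : ℝ => y ^ (1 - 2*s)) (Ioc 0 (max R 0)) := by
      have := intervalIntegral.intervalIntegrable_rpow' (a := 0) (b := max R 0) (r := 1 - 2*s)
        (by linarith [hs.2])
      rwa [intervalIntegrable_iff_integrableOn_Ioc_of_le (le_max_right _ _)] at this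
    refine h1.mono_set ?_
    rintro y ⟨h1, h2⟩
    exact ⟨h2, le_max_of_le_left h1⟩
  exact h.lintegral_lt_top

lemma wt_fin {s : ℝ} (hs : s ∈ Ioo (0:ℝ) 1) : IsFiniteMeasureOnCompacts (wt s) := by
  refine ⟨fun K hK => ?_⟩
  obtain ⟨R, hR⟩ := hK.bddAbove
  exact (measure_mono (fun x hx => hR hx)).trans_lt (wt_Iic_lt_top hs R)

instance (s : ℝ) : SFinite (wt s) := by unfold wt; infer_instance

instance (n : ℕ) (s : ℝ) : SFinite (mu n s) := by unfold mu; infer_instance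

lemma wt_sigma (s : ℝ) : SigmaFinite (wt s) := by
  unfold wt
  exact SigmaFinite.withDensity_ofReal _

lemma mu_fin (n : ℕ) {s : ℝ} (hs : s ∈ Ioo (0:ℝ) 1) : IsFiniteMeasureOnCompacts (mu n s) := by
  haveI := wt_fin hs
  unfold mu
  infer_instance

lemma int_mu {n : ℕ} {s : ℝ} (hs : s ∈ Ioo (0:ℝ) 1) {F : Euc n × ℝ → ℝ} (hF : Continuous F)
    (hc : HasCompactSupport F) : Integrable F (mu n s) := by
  haveI := mu_fin n hs
  exact hF.integrable_of_hasCompactSupport hc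

lemma integral_wt (s : ℝ) (F : ℝ → ℝ) :
    ∫ y, F y ∂(wt s) = ∫ y in Ioi (0:ℝ), y ^ (1 - 2*s) * F y := by
  unfold wt
  rw [integral_withDensity_eq_integral_toReal_smul (by fun_prop) (by simp)]
  refine setIntegral_congr_fun measurableSet_Ioi (fun y hy => ?_)
  have : 0 ≤ y ^ (1 - 2*s) := Real.rpow_nonneg (le_of_lt hy) _
  simp [ENNReal.toReal_ofReal this]

lemma integral_mu {n : ℕ} {s : ℝ} {F : Euc n × ℝ → ℝ} (hF : Integrable F (mu n s)) :
    ∫ X, F X ∂(mu n s) = ∫ x, ∫ y in Ioi (0:ℝ), y ^ (1 - 2*s) * F (x, y) := by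
  unfold mu at *
  rw [integral_prod _ hF]
  simp_rw [integral_wt]

lemma mu_eq (n : ℕ) (s : ℝ) : mu n s = (volume.restrict (univ ×ˢ Ioi (0:ℝ))).withDensity
    (fun X : Euc n × ℝ => ENNReal.ofReal (X.2 ^ (1 - 2*s))) := by
  unfold mu wt
  rw [prod_withDensity_right (by fun_prop), Measure.volume_eq_prod, ← Measure.prod_restrict,
    Measure.restrict_univ]

lemma integral_mu' (n : ℕ) (s : ℝ) (F : Euc n × ℝ → ℝ) :
    ∫ X, F X ∂(mu n s) = ∫ X in univ ×ˢ Ioi (0:ℝ), X.2 ^ (1 - 2*s) * F X := by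
  rw [mu_eq, integral_withDensity_eq_integral_toReal_smul (by fun_prop) (by simp)]
  refine setIntegral_congr_fun (MeasurableSet.univ.prod measurableSet_Ioi) (fun y hy => ?_)
  have : 0 ≤ y.2 ^ (1 - 2*s) := Real.rpow_nonneg (le_of_lt hy.2) _
  simp [ENNReal.toReal_ofReal this]

lemma ae_mu_pos (n : ℕ) (s : ℝ) : ∀ᵐ X ∂(mu n s), 0 < X.2 := by
  rw [mu_eq]
  refine (withDensity_absolutelyContinuous _ _).ae_le ?_
  filter_upwards [ae_restrict_mem (MeasurableSet.univ.prod measurableSet_Ioi)] with X hX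
  exact hX.2

lemma Tst.diff {n : ℕ} {u : Euc n × ℝ → ℝ} (h : Tst n u) : Differentiable ℝ u :=
  h.1.differentiable (by simp)

lemma Tst.cont_fderiv {n : ℕ} {u : Euc n × ℝ → ℝ} (h : Tst n u) : Continuous (fderiv ℝ u) :=
  h.1.continuous_fderiv (by simp)

lemma Tst.cont_gsq {n : ℕ} {u : Euc n × ℝ → ℝ} (h : Tst n u) : Continuous (gsq n u) := by
  unfold gsq
  have := h.cont_fderiv
  fun_prop

lemma gsq_zero_of {n : ℕ} {u : Euc n × ℝ → ℝ} {X} (h : fderiv ℝ u X = 0) : gsq n u X = 0 := by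
  simp [gsq, h]

lemma Tst.supp_gsq {n : ℕ} {u : Euc n × ℝ → ℝ} (h : Tst n u) : HasCompactSupport (gsq n u) := by
  refine (h.2.fderiv ℝ).mono ?_
  intro X hX hX'
  exact hX (gsq_zero_of hX')

lemma gsq_nonneg {n : ℕ} (u : Euc n × ℝ → ℝ) (X) : 0 ≤ gsq n u X := by
  unfold gsq; positivity

lemma Tst.int_gsq {n : ℕ} {s : ℝ} (hs : s ∈ Ioo (0:ℝ) 1) {u : Euc n × ℝ → ℝ} (h : Tst n u) :
    Integrable (gsq n u) (mu n s) := int_mu hs h.cont_gsq h.supp_gsq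

lemma En_nonneg {n : ℕ} {s : ℝ} (u : Euc n × ℝ → ℝ) : 0 ≤ En n s u :=
  integral_nonneg (gsq_nonneg u)

lemma pdX_eq {n : ℕ} {w : Euc n → ℝ → ℝ} {x : Euc n} {y : ℝ}
    (h : DifferentiableAt ℝ (fun p : Euc n × ℝ => w p.1 p.2) (x, y)) (i : Fin n) :
    pdX n w i x y = fderiv ℝ (fun p : Euc n × ℝ => w p.1 p.2) (x, y) (EuclideanSpace.single i 1, 0) := by
  have h1 : HasFDerivAt (fun x' : Euc n => (x', y)) (ContinuousLinearMap.inl ℝ (Euc n) ℝ) x :=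
    hasFDerivAt_prodMk_left x y
  have := (h.hasFDerivAt.comp x h1).fderiv
  unfold pdX
  rw [show (fun x' => w x' y) = (fun p : Euc n × ℝ => w p.1 p.2) ∘ (fun x' : Euc n => (x', y)) from rfl,
    this]
  simp

lemma pdY_eq {n : ℕ} {w : Euc n → ℝ → ℝ} {x : Euc n} {y : ℝ}
    (h : DifferentiableAt ℝ (fun p : Euc n × ℝ => w p.1 p.2) (x, y)) :
    pdY n w x y = fderiv ℝ (fun p : Euc n × ℝ => w p.1 p.2) (x, y) (0, 1) := by
  have h1 : HasFDerivAt (fun y' : ℝ => (x, y')) (ContinuousLinearMap.inr ℝ (Euc n) ℝ) y :=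
    hasFDerivAt_prodMk_right x y
  have := (h.hasFDerivAt.comp y h1).fderiv
  unfold pdY
  rw [show (fun y' => w x y') = (fun p : Euc n × ℝ => w p.1 p.2) ∘ (fun y' : ℝ => (x, y')) from rfl,
    ← fderiv_apply_one_eq_deriv, this]
  simp

lemma vol_aff {n : ℕ} (L : Euc n ≃L[ℝ] Euc n) (b : Euc n) (φ : Euc n → ℝ) :
    ∫ x, φ (L x + b) = |LinearMap.det (L : Euc n →ₗ[ℝ] Euc n)|⁻¹ * ∫ x, φ x := by
  have hd : LinearMap.det (L : Euc n →ₗ[ℝ] Euc n) ≠ 0 := (LinearEquiv.isUnit_det' L.toLinearEquiv).ne_zero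
  have h1 := Measure.map_linearMap_addHaar_eq_smul_addHaar (volume : Measure (Euc n)) hd
  have h2 : ∫ x, φ (L x + b) = ∫ z, φ (z + b) ∂(Measure.map (L : Euc n →ₗ[ℝ] Euc n) volume) := by
    have := (L.toHomeomorph.measurableEmbedding.integral_map (μ := volume) (fun z => φ (z + b)))
    exact this.symm
  rw [h2, h1, integral_smul_measure, integral_add_right_eq_self (fun z => φ z) b,
    ENNReal.toReal_ofReal (abs_nonneg _), abs_inv]
  rfl

lemma int_aff {n : ℕ} {s : ℝ} (hs : s ∈ Ioo (0:ℝ) 1) (L : Euc n ≃L[ℝ] Euc n) (b : Euc n) {τ : ℝ}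
    (hτ : 0 < τ) {H : Euc n × ℝ → ℝ} (hH : Continuous H) (hc : HasCompactSupport H) :
    ∫ X, H (L X.1 + b, τ * X.2) ∂(mu n s) =
      |LinearMap.det (L : Euc n →ₗ[ℝ] Euc n)|⁻¹ * (τ ^ (2 - 2*s))⁻¹ * ∫ X, H X ∂(mu n s) := by
  let Φ : Euc n × ℝ ≃ₜ Euc n × ℝ :=
    (L.toHomeomorph.trans (Homeomorph.addRight b)).prodCongr (Homeomorph.mulLeft₀ τ hτ.ne')
  have hΦ : ∀ X : Euc n × ℝ, Φ X = (L X.1 + b, τ * X.2) := fun X => rfl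
  have hc2 : HasCompactSupport (fun X : Euc n × ℝ => H (L X.1 + b, τ * X.2)) :=
    hc.comp_homeomorph Φ
  rw [integral_mu (int_mu hs hH hc), integral_mu (int_mu hs (by fun_prop) hc2)]
  have inner : ∀ x, ∫ y in Ioi (0:ℝ), y ^ (1 - 2*s) * H (L x + b, τ * y) =
      (τ ^ (2 - 2*s))⁻¹ * ∫ y in Ioi (0:ℝ), y ^ (1 - 2*s) * H (L x + b, y) := by
    intro x
    have := integral_comp_mul_left_Ioi (fun y => y ^ (1 - 2*s) * H (L x + b, y)) 0 hτ
    rw [mul_zero] at this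
    have e : ∫ y in Ioi (0:ℝ), (τ * y) ^ (1 - 2*s) * H (L x + b, τ * y)
        = τ ^ (1-2*s) * ∫ y in Ioi (0:ℝ), y ^ (1 - 2*s) * H (L x + b, τ * y) := by
      rw [← integral_const_mul]
      refine setIntegral_congr_fun measurableSet_Ioi (fun y hy => ?_)
      rw [Real.mul_rpow hτ.le (le_of_lt hy)]; ring
    rw [e] at this
    have h3 : τ ^ (2 - 2*s) = τ ^ (1 - 2*s) * τ := by
      rw [← Real.rpow_add_one hτ.ne']; congr 1; ring
    have h4 : τ ^ (1 - 2*s) ≠ 0 := (Real.rpow_pos_of_pos hτ _).ne'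
    rw [h3, mul_inv, mul_assoc, ← smul_eq_mul (a := τ⁻¹), ← this]
    field_simp
  simp_rw [inner]
  rw [integral_const_mul, vol_aff L b (fun z => ∫ y in Ioi (0:ℝ), y ^ (1 - 2*s) * H (z, y))]
  ring

lemma Tst.aff {n : ℕ} {u : Euc n × ℝ → ℝ} (h : Tst n u) (L : Euc n ≃L[ℝ] Euc n) (b : Euc n) {τ : ℝ}
    (hτ : 0 < τ) (c : ℝ) : Tst n (fun X => c * u (L X.1 + b, τ * X.2)) := by
  let Φ : Euc n × ℝ ≃ₜ Euc n × ℝ :=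
    (L.toHomeomorph.trans (Homeomorph.addRight b)).prodCongr (Homeomorph.mulLeft₀ τ hτ.ne')
  have hc2 : HasCompactSupport (fun X : Euc n × ℝ => u (L X.1 + b, τ * X.2)) :=
    h.2.comp_homeomorph Φ
  refine ⟨?_, hc2.mul_left⟩
  refine contDiff_const.mul (h.1.comp ?_)
  exact ((L.contDiff.comp contDiff_fst).add contDiff_const).prodMk (contDiff_const.mul contDiff_snd)

lemma fderiv_aff {n : ℕ} {u : Euc n × ℝ → ℝ} (h : Tst n u) (L : Euc n ≃L[ℝ] Euc n) (b : Euc n) (τ : ℝ)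
    (c : ℝ) (X V : Euc n × ℝ) : fderiv ℝ (fun X => c * u (L X.1 + b, τ * X.2)) X V =
      c * fderiv ℝ u (L X.1 + b, τ * X.2) (L V.1, τ * V.2) := by
  have h1 : HasFDerivAt (fun X : Euc n × ℝ => (L X.1 + b, τ * X.2))
      (((L : Euc n →L[ℝ] Euc n).comp (ContinuousLinearMap.fst ℝ _ _)).prod
        (τ • ContinuousLinearMap.snd ℝ (Euc n) ℝ)) X := by
    refine HasFDerivAt.prodMk ?_ ?_
    · exact (((L : Euc n →L[ℝ] Euc n).hasFDerivAt).comp X hasFDerivAt_fst).add_const b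
    · exact hasFDerivAt_snd.const_smul τ
  have h2 := ((h.diff (L X.1 + b, τ * X.2)).hasFDerivAt.comp X h1).const_mul c
  rw [show (fun X : Euc n × ℝ => c * u (L X.1 + b, τ * X.2)) =
    (fun X => c * (u ∘ fun X : Euc n × ℝ => (L X.1 + b, τ * X.2)) X) from rfl, h2.fderiv]
  simp

/-- scaling by `ρ` about `b`. -/
lemma sc_gsq {n : ℕ} {u : Euc n × ℝ → ℝ} (h : Tst n u) (b : Euc n) {ρ : ℝ} (hρ : 0 < ρ) (c : ℝ) (X) :
    gsq n (fun X => c * u (ρ • X.1 + b, ρ * X.2)) X = c ^ 2 * ρ ^ 2 * gsq n u (ρ • X.1 + b, ρ * X.2) := by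
  let L : Euc n ≃L[ℝ] Euc n := ContinuousLinearEquiv.smulLeft (Units.mk0 ρ hρ.ne')
  have hL : ∀ x, L x = ρ • x := fun x => rfl
  have := fderiv_aff h L b ρ c
  simp only [hL] at this
  unfold gsq
  simp only [this]
  have e1 : ∀ i : Fin n, ((ρ • EuclideanSpace.single i (1:ℝ) : Euc n), ρ * (0:ℝ)) =
    ρ • ((EuclideanSpace.single i (1:ℝ) : Euc n), (0:ℝ)) := fun i => by simp
  have e2 : ((ρ • (0 : Euc n)), ρ * (1:ℝ)) = ρ • ((0 : Euc n), (1:ℝ)) := by simp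
  simp only [e1, e2, map_smul, smul_eq_mul]
  rw [mul_add, Finset.mul_sum]
  congr 1
  · exact Finset.sum_congr rfl fun i _ => by ring
  · ring

lemma det_sc {n : ℕ} {ρ : ℝ} (hρ : 0 < ρ) :
   |LinearMap.det ((ContinuousLinearEquiv.smulLeft (Units.mk0 ρ hρ.ne') : Euc n ≃L[ℝ] Euc n) : Euc n →ₗ[ℝ] Euc n)| = ρ ^ n := by
  have : ((ContinuousLinearEquiv.smulLeft (Units.mk0 ρ hρ.ne') : Euc n ≃L[ℝ] Euc n) : Euc n →ₗ[ℝ] Euc n)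
    = ρ • LinearMap.id := by ext x; rfl
  rw [this, LinearMap.det_smul]
  simp [abs_of_pos hρ]

lemma sc_int {n : ℕ} {s : ℝ} (hs : s ∈ Ioo (0:ℝ) 1) (b : Euc n) {ρ : ℝ}
    (hρ : 0 < ρ) {H : Euc n × ℝ → ℝ} (hH : Continuous H) (hc : HasCompactSupport H) :
    ∫ X, H (ρ • X.1 + b, ρ * X.2) ∂(mu n s) = (ρ ^ ((n:ℝ) + 2 - 2*s))⁻¹ * ∫ X, H X ∂(mu n s) := by
  have := int_aff hs (ContinuousLinearEquiv.smulLeft (Units.mk0 ρ hρ.ne')) b hρ hH hc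
  rw [det_sc hρ] at this
  have e : ρ ^ ((n:ℝ) + 2 - 2*s) = ρ ^ n * ρ ^ (2 - 2*s) := by
    rw [← Real.rpow_natCast, ← Real.rpow_add hρ]; congr 1; ring
  rw [e, mul_inv]
  exact this

lemma sc_vol {n : ℕ} (b : Euc n) {ρ : ℝ} (hρ : 0 < ρ) (φ : Euc n → ℝ) :
    ∫ x, φ (ρ • x + b) = (ρ ^ n)⁻¹ * ∫ x, φ x := by
  have := vol_aff (ContinuousLinearEquiv.smulLeft (Units.mk0 ρ hρ.ne')) b φ
  rw [det_sc hρ] at this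
  exact this

lemma Tst.sc {n : ℕ} {u : Euc n × ℝ → ℝ} (h : Tst n u) (b : Euc n) {ρ : ℝ}
    (hρ : 0 < ρ) (c : ℝ) : Tst n (fun X => c * u (ρ • X.1 + b, ρ * X.2)) :=
  h.aff (ContinuousLinearEquiv.smulLeft (Units.mk0 ρ hρ.ne')) b hρ c

lemma sc_En {n : ℕ} {s : ℝ} (hs : s ∈ Ioo (0:ℝ) 1) {u : Euc n × ℝ → ℝ} (h : Tst n u) (b : Euc n) {ρ : ℝ}
    (hρ : 0 < ρ) (c : ℝ) : En n s (fun X => c * u (ρ • X.1 + b, ρ * X.2)) =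
      c ^ 2 * (ρ ^ ((n:ℝ) - 2*s))⁻¹ * En n s u := by
  unfold En
  simp only [sc_gsq h b hρ]
  rw [integral_const_mul, sc_int hs b hρ h.cont_gsq h.supp_gsq]
  have e : ρ ^ ((n:ℝ) + 2 - 2*s) = ρ ^ ((n:ℝ) - 2*s) * ρ ^ 2 := by
    rw [← Real.rpow_natCast, ← Real.rpow_add hρ]; congr 1; push_cast; ring
  have : ρ ^ ((n:ℝ) - 2*s) ≠ 0 := (Real.rpow_pos_of_pos hρ _).ne'
  rw [e]
  field_simp

/-- Euler identity. -/
lemma euler_int {n : ℕ} {s : ℝ} (hs : s ∈ Ioo (0:ℝ) 1) {w : Euc n × ℝ → ℝ} (h : Tst n w) :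
    ∫ X, (fderiv ℝ w X X + ((n:ℝ) + 2 - 2*s) * w X) ∂(mu n s) = 0 := by
  have := mu_fin n hs
  set N := (n:ℝ) + 2 - 2*s
  obtain ⟨R0, hR0⟩ := h.2.isBounded.subset_closedBall 0
  set R := max R0 0
  have hR : tsupport w ⊆ Metric.closedBall 0 R :=
    hR0.trans (Metric.closedBall_subset_closedBall (le_max_left _ _))
  have hR0' : 0 ≤ R := le_max_right _ _
  obtain ⟨M, hM⟩ := (h.2.fderiv ℝ).exists_bound_of_continuous h.cont_fderiv
  have hM0 : 0 ≤ M := (norm_nonneg _).trans (hM 0)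
  have key : HasDerivAt (fun τ : ℝ => ∫ X, w (τ • X) ∂(mu n s)) (∫ X, fderiv ℝ w ((1:ℝ) • X) X ∂(mu n s)) 1 := by
    refine (hasDerivAt_integral_of_dominated_loc_of_deriv_le (F := fun τ X => w (τ • X))
      (F' := fun τ X => fderiv ℝ w (τ • X) X) (s := Metric.ball 1 (1/2))
      (bound := (Metric.closedBall (0 : Euc n × ℝ) (2*R)).indicator (fun _ => M * (2 * R)))
      (Metric.ball_mem_nhds _ (by norm_num)) ?_ ?_ ?_ ?_ ?_ ?_).2
    · refine Eventually.of_forall fun τ => ?_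
      have := h.1.continuous
      exact (show Continuous fun X => w (τ • X) by fun_prop).aestronglyMeasurable
    · simpa using int_mu hs h.1.continuous h.2
    · have := h.cont_fderiv
      exact (show Continuous fun X : Euc n × ℝ => fderiv ℝ w ((1:ℝ) • X) X by fun_prop).aestronglyMeasurable
    · refine Eventually.of_forall fun X τ hτ => ?_
      have hτ' : 1/2 < τ := by
        have := abs_lt.1 (by simpa [Real.dist_eq] using hτ : |τ - 1| < 2⁻¹)
        linarith [this.1]
      by_cases hX : X ∈ Metric.closedBall (0 : Euc n × ℝ) (2*R)
      · rw [indicator_of_mem hX]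
        refine (ContinuousLinearMap.le_opNorm _ _).trans ?_
        have : ‖X‖ ≤ 2 * R := by simpa using hX
        gcongr
        exact hM _
      · rw [indicator_of_notMem hX]
        have h0 : fderiv ℝ w (τ • X) = 0 := by
          by_contra h0
          have h1 : τ • X ∈ tsupport w := support_fderiv_subset ℝ h0
          have h2 := hR h1
          simp only [mem_closedBall_zero_iff, norm_smul, Real.norm_eq_abs, not_le] at h2 hX
          rw [abs_of_pos (by linarith)] at h2
          nlinarith [norm_nonneg X]
        simp [h0]
    · refine (integrable_indicator_iff measurableSet_closedBall).2 ?_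
      exact integrableOn_const ((isCompact_closedBall _ _).measure_lt_top.ne)
    · refine Eventually.of_forall fun X τ _ => ?_
      have h1 : HasDerivAt (fun τ : ℝ => τ • X) X τ := by
        simpa using (hasDerivAt_id τ).smul_const X
      exact (h.diff _).hasFDerivAt.comp_hasDerivAt τ h1
  have key2 : HasDerivAt (fun τ : ℝ => ∫ X, w (τ • X) ∂(mu n s)) (-N * ∫ X, w X ∂(mu n s)) 1 := by
    have h1 : HasDerivAt (fun τ : ℝ => τ ^ (-N) * ∫ X, w X ∂(mu n s)) (-N * ∫ X, w X ∂(mu n s)) 1 := by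
      have := (Real.hasDerivAt_rpow_const (x := 1) (p := -N) (Or.inl one_ne_zero)).mul_const (∫ X, w X ∂(mu n s))
      simpa using this
    refine h1.congr_of_eventuallyEq ?_
    filter_upwards [lt_mem_nhds (show (0:ℝ) < 1 by norm_num)] with τ hτ
    have := sc_int hs (0 : Euc n) hτ h.1.continuous h.2
    rw [Real.rpow_neg hτ.le, ← this]
    refine integral_congr_ae (Eventually.of_forall fun X => ?_)
    simp [Prod.smul_def]
  have e := key.unique key2
  simp only [one_smul] at e
  have i1 : Integrable (fun X => fderiv ℝ w X X) (mu n s) := by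
    refine int_mu hs ?_ ?_
    · have := h.cont_fderiv
      fun_prop
    · refine (h.2.fderiv ℝ).mono ?_
      intro X hX h0
      exact hX (by simp [h0])
  rw [integral_add i1 ((int_mu hs h.1.continuous h.2).const_mul N), e, integral_const_mul]
  ring

section inversion
variable {E : Type*} [NormedAddCommGroup E] [NormedSpace ℝ E]

lemma quad_hasFDeriv (B : E →L[ℝ] E →L[ℝ] ℝ) (hsym : ∀ x y, B x y = B y x) (x : E) :
    HasFDerivAt (fun x => B x x) ((2:ℝ) • B x) x := by
  have := HasFDerivAt.comp (g := fun p : E × E => B p.1 p.2) (f := fun x : E => (x, x)) x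
    (B.isBoundedBilinearMap.hasFDerivAt (x, x)) ((hasFDerivAt_id x).prodMk (hasFDerivAt_id x))
  refine this.congr_fderiv ?_
  ext v
  simp [hsym v x]; ring

lemma inv_hasFDeriv (B : E →L[ℝ] E →L[ℝ] ℝ) (hsym : ∀ x y, B x y = B y x)
    {x : E} (hx : B x x ≠ 0) :
    HasFDerivAt (fun x => (B x x)⁻¹ • x)
      ((B x x)⁻¹ • (ContinuousLinearMap.id ℝ E - (2 * (B x x)⁻¹) • (B x).smulRight x)) x := by
  have h1 := quad_hasFDeriv B hsym x
  have h2 := HasDerivAt.comp_hasFDerivAt (f := fun x => B x x) x (hasDerivAt_inv hx) h1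
  have h3 := h2.smul (hasFDerivAt_id x)
  refine h3.congr_fderiv ?_
  ext v
  simp only [_root_.add_apply, _root_.smul_apply, Function.comp, id,
    ContinuousLinearMap.smulRight_apply, _root_.sub_apply, ContinuousLinearMap.id_apply,
    smul_eq_mul, smul_sub, smul_smul]
  rw [sub_eq_add_neg, ← neg_smul]
  congr 2
  field_simp

lemma inv_det [FiniteDimensional ℝ E] (B : E →L[ℝ] E →L[ℝ] ℝ)
    {x : E} (hx : 0 < B x x) :
    |((B x x)⁻¹ • (ContinuousLinearMap.id ℝ E - (2 * (B x x)⁻¹) • (B x).smulRight x)).det|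
      = ((B x x)⁻¹) ^ (Module.finrank ℝ E) := by
  set S : E →ₗ[ℝ] E := ((ContinuousLinearMap.id ℝ E - (2 * (B x x)⁻¹) • (B x).smulRight x : E →L[ℝ] E) : E →ₗ[ℝ] E) with hS
  have hSv : ∀ v, S v = v - (2 * (B x x)⁻¹ * B x v) • x := by
    intro v; simp [hS, smul_smul]
  have h1 : S * S = 1 := by
    ext v
    simp only [Module.End.mul_apply, Module.End.one_apply]
    rw [hSv, hSv]
    simp only [map_sub, map_smul, smul_eq_mul]
    rw [sub_sub, ← add_smul]
    have : (2 * (B x x)⁻¹ * (B x) v + 2 * (B x x)⁻¹ * ((B x) v - 2 * (B x x)⁻¹ * (B x) v * (B x) x)) = 0 := by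
      field_simp
      ring
    rw [this]; simp
  have h2 : LinearMap.det S * LinearMap.det S = 1 := by
    rw [← map_mul, h1, map_one]
  have h3 : |LinearMap.det S| = 1 := by
    have := mul_self_eq_one_iff.1 h2
    rcases this with h | h <;> simp [h]
  rw [ContinuousLinearMap.det, ContinuousLinearMap.toLinearMap_smul, LinearMap.det_smul, abs_mul, h3, mul_one, abs_of_pos (by positivity)]

lemma inv_inv' (B : E →L[ℝ] E →L[ℝ] ℝ) {x : E} (hx : B x x ≠ 0) :
    (B ((B x x)⁻¹ • x) ((B x x)⁻¹ • x))⁻¹ • ((B x x)⁻¹ • x) = x := by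
  simp only [map_smul, smul_apply, smul_eq_mul, smul_smul]
  have : ((B x x)⁻¹ * ((B x x)⁻¹ * (B x) x))⁻¹ * (B x x)⁻¹ = 1 := by field_simp
  rw [this, one_smul]

lemma inv_cov [FiniteDimensional ℝ E] [MeasurableSpace E] [BorelSpace E] (μ : Measure E)
    [μ.IsAddHaarMeasure] (B : E →L[ℝ] E →L[ℝ] ℝ) (hsym : ∀ x y, B x y = B y x)
    (hpos : ∀ x, x ≠ 0 → 0 < B x x) {S : Set E} (hS : MeasurableSet S) (h0 : (0:E) ∉ S)
    (hinv : ∀ x ∈ S, (B x x)⁻¹ • x ∈ S) (Ψ : E → ℝ) :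
    ∫ x in S, ((B x x)⁻¹) ^ (Module.finrank ℝ E) * Ψ ((B x x)⁻¹ • x) ∂μ = ∫ x in S, Ψ x ∂μ := by
  have hp : ∀ x ∈ S, 0 < B x x := fun x hx => hpos x (fun h => h0 (h ▸ hx))
  have him : (fun x => (B x x)⁻¹ • x) '' S = S := by
    ext x
    constructor
    · rintro ⟨z, hz, rfl⟩; exact hinv z hz
    · intro hx
      exact ⟨_, hinv x hx, inv_inv' B (hp x hx).ne'⟩
  have hinj : InjOn (fun x => (B x x)⁻¹ • x) S := by
    intro x hx z hz hxz
    simp only at hxz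
    rw [← inv_inv' B (hp x hx).ne', hxz, inv_inv' B (hp z hz).ne']
  have := integral_image_eq_integral_abs_det_fderiv_smul μ hS
    (fun x hx => (inv_hasFDeriv B hsym (hp x hx).ne').hasFDerivWithinAt) hinj Ψ
  rw [him] at this
  rw [this]
  refine setIntegral_congr_fun hS fun x hx => ?_
  simp only [smul_eq_mul]
  rw [inv_det B (hp x hx)]

end inversion

/-- Euclidean form on the product. -/
def BP (n : ℕ) : (Euc n × ℝ) →L[ℝ] (Euc n × ℝ) →L[ℝ] ℝ :=
  (innerSL ℝ : Euc n →L[ℝ] Euc n →L[ℝ] ℝ).bilinearComp (ContinuousLinearMap.fst ℝ _ _) (ContinuousLinearMap.fst ℝ _ _)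
  + (ContinuousLinearMap.mul ℝ ℝ).bilinearComp (ContinuousLinearMap.snd ℝ _ _) (ContinuousLinearMap.snd ℝ _ _)

lemma BP_apply {n : ℕ} (X Y : Euc n × ℝ) : BP n X Y = inner ℝ X.1 Y.1 + X.2 * Y.2 := by
  simp [BP]

/-- squared Euclidean norm on the product -/
def nq {n : ℕ} (X : Euc n × ℝ) : ℝ := BP n X X

lemma nq_eq {n : ℕ} (X : Euc n × ℝ) : nq X = ‖X.1‖ ^ 2 + X.2 ^ 2 := by
  rw [nq, BP_apply, real_inner_self_eq_norm_sq]; ring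

lemma nq_nonneg {n : ℕ} (X : Euc n × ℝ) : 0 ≤ nq X := by rw [nq_eq]; positivity

lemma nq_pos {n : ℕ} {X : Euc n × ℝ} (h : X ≠ 0) : 0 < nq X := by
  rw [nq_eq]
  by_contra h'
  apply h
  have h1 : ‖X.1‖ ^ 2 = 0 := by nlinarith [sq_nonneg ‖X.1‖, sq_nonneg X.2]
  have h2 : X.2 ^ 2 = 0 := by nlinarith [sq_nonneg ‖X.1‖, sq_nonneg X.2]
  ext1
  · simpa using h1
  · simpa using h2

lemma nq_smul {n : ℕ} (c : ℝ) (X : Euc n × ℝ) : nq (c • X) = c ^ 2 * nq X := by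
  simp [nq]; ring

lemma nq_cd {n : ℕ} : ContDiff ℝ (⊤ : ℕ∞) (nq : Euc n × ℝ → ℝ) := by
  have : (nq : Euc n × ℝ → ℝ) = fun X => ‖X.1‖ ^ 2 + X.2 ^ 2 := funext nq_eq
  rw [this]
  exact (contDiff_fst.norm_sq ℝ).add (contDiff_snd.pow 2)

lemma BP_symm {n : ℕ} (X Y : Euc n × ℝ) : BP n X Y = BP n Y X := by
  rw [BP_apply, BP_apply, real_inner_comm, mul_comm X.2]

lemma BP_basis {n : ℕ} (X : Euc n × ℝ) (i : Fin n) :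
    BP n X (EuclideanSpace.single i 1, 0) = X.1 i := by
  simp [BP_apply, EuclideanSpace.inner_single_right]

lemma decomp {n : ℕ} (X : Euc n × ℝ) :
    X = (∑ i, X.1 i • ((EuclideanSpace.single i (1:ℝ) : Euc n), (0:ℝ))) + X.2 • ((0 : Euc n), (1:ℝ)) := by
  ext i
  · simp [Prod.fst_sum, Pi.single_apply]
  · simp [Prod.snd_sum]

lemma lin_decomp {n : ℕ} (l : Euc n × ℝ →L[ℝ] ℝ) (X : Euc n × ℝ) :
    l X = (∑ i, X.1 i * l (EuclideanSpace.single i 1, 0)) + X.2 * l (0, 1) := by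
  conv_lhs => rw [decomp X]
  simp only [map_add, map_sum, map_smul, smul_eq_mul]

lemma nq_sum {n : ℕ} (X : Euc n × ℝ) : nq X = (∑ i, X.1 i ^ 2) + X.2 ^ 2 := by
  rw [nq_eq, EuclideanSpace.real_norm_sq_eq]

/-- Pointwise Kelvin transform of the squared gradient -/
lemma kelvin_alg {n : ℕ} (l : Euc n × ℝ →L[ℝ] ℝ) (X : Euc n × ℝ) (c : ℝ) :
    (∑ i, (l (EuclideanSpace.single i 1, 0) - BP n X (EuclideanSpace.single i 1, 0) * c) ^ 2)
      + (l (0, 1) - BP n X (0,1) * c) ^ 2 =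
    ((∑ i, (l (EuclideanSpace.single i 1, 0)) ^ 2) + (l (0,1)) ^ 2) - 2 * c * l X + c ^ 2 * nq X := by
  have e : BP n X (0,1) = X.2 := by simp [BP_apply]
  rw [lin_decomp l X, nq_sum, e]
  simp only [BP_basis]
  simp only [sub_sq, Finset.sum_add_distrib, Finset.sum_sub_distrib, mul_add, Finset.mul_sum, mul_pow]
  have e1 : ∀ i : Fin n, 2 * l (EuclideanSpace.single i 1, 0) * (X.1 i * c)
    = 2 * c * (X.1 i * l (EuclideanSpace.single i 1, 0)) := fun i => by ring
  have e2 : ∀ i : Fin n, X.1 i ^ 2 * c ^ 2 = c ^ 2 * X.1 i ^ 2 := fun i => by ring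
  simp only [e1, e2]
  ring

/-- Kelvin transform with parameter `m`. -/
def kel {n : ℕ} (m : ℝ) (u : Euc n × ℝ → ℝ) (X : Euc n × ℝ) : ℝ :=
  (nq X) ^ (-m/2) * u ((nq X)⁻¹ • X)

lemma kel_fderiv {n : ℕ} (m : ℝ) {u : Euc n × ℝ → ℝ} (hu : Differentiable ℝ u) {X : Euc n × ℝ} (hX : X ≠ 0)
    (V : Euc n × ℝ) :
    fderiv ℝ (kel m u) X V = (nq X) ^ (-m/2 - 1) *
      (fderiv ℝ u ((nq X)⁻¹ • X) V - BP n X V * (2 * (nq X)⁻¹ * fderiv ℝ u ((nq X)⁻¹ • X) X + m * u ((nq X)⁻¹ • X))) := by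
  have hq := nq_pos hX
  have h1 : HasFDerivAt (fun X : Euc n × ℝ => (nq X)⁻¹ • X) _ X := inv_hasFDeriv (BP n) BP_symm hq.ne'
  have h2 := HasFDerivAt.comp (f := fun X : Euc n × ℝ => (nq X)⁻¹ • X) X ((hu ((nq X)⁻¹ • X)).hasFDerivAt) h1
  have h3 : HasFDerivAt (fun x : Euc n × ℝ => nq x) ((2:ℝ) • BP n X) X := quad_hasFDeriv (BP n) BP_symm X
  have h4 := h3.rpow_const (p := -m/2) (Or.inl hq.ne')
  have h5 := (h4.mul h2).fderiv
  have : kel m u = (fun x => nq x ^ (-m / 2)) * (u ∘ fun X => (nq X)⁻¹ • X) := rfl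
  rw [this, h5]
  have e : nq X ^ (-m/2) = nq X ^ (-m/2 - 1) * nq X := by
    rw [← Real.rpow_add_one hq.ne']; congr 1; ring
  simp only [_root_.add_apply, _root_.smul_apply, ContinuousLinearMap.comp_apply,
    _root_.sub_apply, ContinuousLinearMap.id_apply, ContinuousLinearMap.smulRight_apply,
    map_smul, map_sub, smul_eq_mul, Function.comp, e]
  rw [show ((BP n) X) X = nq X from rfl]
  field_simp
  ring

lemma kel_gsq {n : ℕ} (m : ℝ) {u : Euc n × ℝ → ℝ} (hu : Differentiable ℝ u) {X : Euc n × ℝ} (hX : X ≠ 0) :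
    gsq n (kel m u) X = (nq X) ^ (-m - 2) *
      (gsq n u ((nq X)⁻¹ • X) + 2 * m * u ((nq X)⁻¹ • X) * fderiv ℝ u ((nq X)⁻¹ • X) X
        + m ^ 2 * (u ((nq X)⁻¹ • X)) ^ 2 * nq X) := by
  have hq := nq_pos hX
  unfold gsq
  simp only [kel_fderiv m hu hX, mul_pow]
  rw [← Finset.mul_sum, ← mul_add, kelvin_alg]
  have : (nq X ^ (-m/2 - 1)) ^ 2 = nq X ^ (-m - 2) := by
    rw [← Real.rpow_natCast, ← Real.rpow_mul hq.le]; congr 1; push_cast; ring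
  rw [this]
  congr 1
  field_simp
  ring

lemma nq_cont {n : ℕ} : Continuous (nq : Euc n × ℝ → ℝ) := nq_cd.continuous

lemma nq_inv {n : ℕ} {X : Euc n × ℝ} : nq ((nq X)⁻¹ • X) = (nq X)⁻¹ := by
  rw [nq_smul]
  by_cases h : nq X = 0
  · simp [h]
  · field_simp

lemma norm_le_nq {n : ℕ} {X : Euc n × ℝ} {R : ℝ} (hR : 0 ≤ R) (h : nq X ≤ R ^ 2) : ‖X‖ ≤ R := by
  rw [nq_eq] at h
  rw [Prod.norm_def]
  refine max_le ?_ ?_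
  · exact abs_le_of_sq_le_sq' (by nlinarith [sq_nonneg X.2]) hR |>.2
  · exact abs_le_of_sq_le_sq (by nlinarith [sq_nonneg ‖X.1‖]) hR

lemma nq_le_norm {n : ℕ} (X : Euc n × ℝ) : nq X ≤ 2 * ‖X‖ ^ 2 := by
  rw [nq_eq]
  have h1 := norm_fst_le X
  have h2 := norm_snd_le X
  have h3 : X.2 ^ 2 = ‖X.2‖ ^ 2 := by simp
  rw [h3]
  have := pow_le_pow_left₀ (norm_nonneg _) h1 2
  have := pow_le_pow_left₀ (norm_nonneg _) h2 2
  linarith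

lemma cd_of_zero {n : ℕ} {g : Euc n × ℝ → ℝ} {r : ℝ} (hr : 0 < r)
    (h0 : ∀ X, nq X < r ^ 2 → g X = 0) (h : ∀ X, X ≠ 0 → ContDiffAt ℝ (⊤ : ℕ∞) g X) :
    ContDiff ℝ (⊤ : ℕ∞) g := by
  rw [contDiff_iff_contDiffAt]
  intro X
  by_cases hX : X = 0
  · have : g =ᶠ[𝓝 X] fun _ => 0 := by
      have hop : IsOpen {X : Euc n × ℝ | nq X < r ^ 2} := isOpen_lt nq_cont continuous_const
      filter_upwards [hop.mem_nhds (show X ∈ {X : Euc n × ℝ | nq X < r ^ 2} by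
        subst hX; simp [nq]; positivity)] with Z hZ
      exact h0 Z hZ
    exact contDiffAt_const.congr_of_eventuallyEq this
  · exact h X hX

lemma kel_supp {n : ℕ} (m : ℝ) {u : Euc n × ℝ → ℝ} {r : ℝ} (hr : 0 < r)
    (h0 : ∀ X, nq X < r ^ 2 → u X = 0) {X : Euc n × ℝ} (hX : kel m u X ≠ 0) : nq X ≤ (r⁻¹) ^ 2 := by
  by_contra h
  push Not at h
  apply hX
  have h1 : 0 < nq X := lt_trans (by positivity) h
  rw [kel, h0, mul_zero]
  rw [nq_inv]
  rw [inv_pow] at h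
  exact inv_lt_of_inv_lt₀ (by positivity) h

lemma kel_tst {n : ℕ} (m : ℝ) {u : Euc n × ℝ → ℝ} (hu : Tst n u) {r : ℝ} (hr : 0 < r)
    (h0 : ∀ X, nq X < r ^ 2 → u X = 0) : Tst n (kel m u) := by
  constructor
  · obtain ⟨R0, hR0⟩ := hu.2.isBounded.subset_closedBall 0
    set R := max R0 1
    have hR1 : 1 ≤ R := le_max_right _ _
    have hR : ∀ X, R < ‖X‖ → u X = 0 := by
      intro X hX
      by_contra h
      have := hR0 (subset_tsupport _ h)
      rw [mem_closedBall_zero_iff] at this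
      exact absurd (this.trans (le_max_left _ _)) (not_le.2 hX)
    refine cd_of_zero (r := (2 * R)⁻¹) (by positivity) ?_ ?_
    · intro X hX
      by_cases hX0 : X = 0
      · subst hX0
        rw [kel, smul_zero, h0 0 (by simp [nq]; positivity), mul_zero]
      have hq := nq_pos hX0
      rw [kel, hR, mul_zero]
      have h1 : (2 * R) ^ 2 < nq ((nq X)⁻¹ • X) := by
        rw [nq_inv]
        rw [inv_pow] at hX
        exact lt_inv_of_lt_inv₀ hq hX
      have h2 := nq_le_norm ((nq X)⁻¹ • X)
      by_contra h3
      push Not at h3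
      have := pow_le_pow_left₀ (norm_nonneg _) h3 2
      nlinarith
    · intro X hX
      have hq := nq_pos hX
      have h1 : ContDiffAt ℝ (⊤ : ℕ∞) (nq : Euc n × ℝ → ℝ) X := nq_cd.contDiffAt
      exact (h1.rpow_const_of_ne hq.ne').mul
        (hu.1.contDiffAt.comp X ((h1.inv hq.ne').smul contDiffAt_id))
  · refine HasCompactSupport.intro (isCompact_closedBall (0 : Euc n × ℝ) (r⁻¹)) ?_
    intro X hX
    by_contra h
    exact hX (by simpa using norm_le_nq (by positivity) (kel_supp m hr h0 h))

lemma kel_En {n : ℕ} {s : ℝ} (hs : s ∈ Ioo (0:ℝ) 1) {u : Euc n × ℝ → ℝ}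
    (hu : Tst n u) {r : ℝ} (hr : 0 < r)
    (h0 : ∀ X, nq X < r ^ 2 → u X = 0) : En n s (kel ((n:ℝ) - 2*s) u) = En n s u := by
  set m := (n:ℝ) - 2*s with hm
  have mU : MeasurableSet ((univ : Set (Euc n)) ×ˢ Ioi (0:ℝ)) := MeasurableSet.univ.prod measurableSet_Ioi
  set w : Euc n × ℝ → ℝ := fun X => (nq X)⁻¹ * u X ^ 2 with hw
  have hwT : Tst n w := by
    constructor
    · refine cd_of_zero hr (fun X hX => by simp [hw, h0 X hX]) (fun X hX => ?_)
      exact ((nq_cd.contDiffAt).inv (nq_pos hX).ne').mul (hu.1.contDiffAt.pow 2)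
    · refine hu.2.mono ?_
      intro X hX h
      exact hX (by simp only [hw, h]; simp)
  have hne : ∀ X ∈ (univ : Set (Euc n)) ×ˢ Ioi (0:ℝ), X ≠ 0 := by
    rintro X ⟨-, hX⟩ rfl
    simp at hX
  set Ψ : Euc n × ℝ → ℝ := fun Z => Z.2 ^ (1 - 2*s) *
    (gsq n u Z + 2 * m * u Z * fderiv ℝ u Z Z * (nq Z)⁻¹ + m ^ 2 * u Z ^ 2 * (nq Z)⁻¹) with hΨ
  have e1 : En n s (kel m u) = ∫ X in univ ×ˢ Ioi (0:ℝ),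
      ((BP n X X)⁻¹) ^ (Module.finrank ℝ (Euc n × ℝ)) * Ψ ((BP n X X)⁻¹ • X) := by
    unfold En
    rw [integral_mu']
    refine setIntegral_congr_fun mU fun X hX => ?_
    have hX0 := hne X hX
    have hq := nq_pos hX0
    have hy : 0 < X.2 := hX.2
    simp only [hΨ, show ((BP n) X) X = nq X from rfl]
    rw [kel_gsq m hu.diff hX0]
    rw [nq_inv, map_smul, inv_inv, smul_eq_mul, Prod.smul_snd, smul_eq_mul,
      Real.mul_rpow (by positivity) hy.le]
    have e : nq X ^ (-m - 2) = ((nq X)⁻¹) ^ (Module.finrank ℝ (Euc n × ℝ)) * ((nq X)⁻¹) ^ (1 - 2*s) := by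
      rw [← Real.rpow_natCast, ← Real.rpow_add (by positivity), Real.inv_rpow hq.le, ← Real.rpow_neg hq.le]
      congr 1
      simp [hm]; ring
    rw [e]
    field_simp
  haveI : (volume : Measure (Euc n × ℝ)).IsAddHaarMeasure := by
    rw [Measure.volume_eq_prod]; infer_instance
  rw [e1, inv_cov volume (BP n) BP_symm (fun X hX => nq_pos hX) mU (by simp) ?_ Ψ]
  · rw [← integral_mu' n s]
    have e2 : ∀ Z, gsq n u Z + 2 * m * u Z * fderiv ℝ u Z Z * (nq Z)⁻¹ + m ^ 2 * u Z ^ 2 * (nq Z)⁻¹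
        = gsq n u Z + m * (fderiv ℝ w Z Z + ((n:ℝ) + 2 - 2*s) * w Z) := by
      intro Z
      by_cases hZ : Z = 0
      · have : u 0 = 0 := h0 0 (by simp [nq]; positivity)
        subst hZ; simp [hw, this]
      have hq := nq_pos hZ
      have h3 : HasFDerivAt (fun x : Euc n × ℝ => nq x) ((2:ℝ) • BP n Z) Z := quad_hasFDeriv (BP n) BP_symm Z
      have h4 := HasDerivAt.comp_hasFDerivAt Z (hasDerivAt_inv hq.ne') h3
      have h5 := (h4.mul ((hu.diff Z).hasFDerivAt.pow 2)).fderiv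
      have h6 : w = (Inv.inv ∘ (fun x : Euc n × ℝ => nq x)) * (fun x => u x ^ 2) := rfl
      rw [h6, h5]
      simp only [_root_.add_apply, _root_.smul_apply, smul_eq_mul, Function.comp, Pi.mul_apply]
      rw [show ((BP n) Z) Z = nq Z from rfl, nsmul_eq_mul]
      simp only [hm]
      field_simp
      push_cast
      ring
    simp only [e2]
    have i2 : Integrable (fun Z => fderiv ℝ w Z Z + ((n:ℝ) + 2 - 2*s) * w Z) (mu n s) := by
      refine Integrable.add (int_mu hs ?_ ?_) ((int_mu hs hwT.1.continuous hwT.2).const_mul _)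
      · have := hwT.cont_fderiv
        fun_prop
      · refine (hwT.2.fderiv ℝ).mono ?_
        intro X hX h0
        exact hX (by simp [h0])
    rw [integral_add (hu.int_gsq hs) (i2.const_mul m), integral_const_mul, euler_int hs hwT, mul_zero,
      add_zero]
    rfl
  · rintro X hX
    refine ⟨trivial, ?_⟩
    have hq := nq_pos (hne X hX)
    have hy : 0 < X.2 := hX.2
    change 0 < ((nq X)⁻¹ • X).2
    rw [Prod.smul_snd, smul_eq_mul]
    positivity

lemma inv_vol {n : ℕ} (hn : 1 ≤ n) (Ψ : Euc n → ℝ) :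
    ∫ x, ((‖x‖ ^ 2)⁻¹) ^ n * Ψ ((‖x‖ ^ 2)⁻¹ • x) = ∫ x, Ψ x := by
  haveI : Nonempty (Fin n) := ⟨⟨0, hn⟩⟩
  have h := inv_cov (volume : Measure (Euc n)) (innerSL ℝ)
    (fun x y => by rw [innerSL_apply_apply, innerSL_apply_apply, real_inner_comm])
    (fun x hx => by rw [innerSL_apply_apply, real_inner_self_eq_norm_sq]; positivity)
    (S := {0}ᶜ) (measurableSet_singleton 0).compl (by simp)
    (fun x hx => by
      rw [innerSL_apply_apply, real_inner_self_eq_norm_sq]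
      have : x ≠ 0 := by simpa using hx
      simpa using this) Ψ
  have e : (volume : Measure (Euc n)).restrict {0}ᶜ = volume := by
    refine Measure.restrict_eq_self_of_ae_mem ?_
    simp [ae_iff]
  rw [e] at h
  simp only [finrank_euclideanSpace, Fintype.card_fin] at h
  refine Eq.trans (integral_congr_ae (Eventually.of_forall fun x => ?_)) h
  change _ = ((inner ℝ x x)⁻¹) ^ n * Ψ ((inner ℝ x x)⁻¹ • x)
  rw [real_inner_self_eq_norm_sq]

lemma kel_tr {n : ℕ} (hn : 1 ≤ n) {m q : ℝ} (hq : m * q = 2 * n) {u : Euc n × ℝ → ℝ} (hu0 : u 0 = 0) (hq0 : q ≠ 0) :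
    ∫ x : Euc n, |kel m u (x, 0)| ^ q = ∫ x : Euc n, |u (x, 0)| ^ q := by
  rw [← inv_vol hn (fun x => |u (x,0)|^q)]
  refine integral_congr_ae (Eventually.of_forall fun x => ?_)
  have e : nq ((x, 0) : Euc n × ℝ) = ‖x‖ ^ 2 := by simp [nq_eq]
  simp only [kel, e]
  by_cases hx : x = 0
  · subst hx
    rw [show ((0 : Euc n), (0:ℝ)) = 0 from rfl]
    simp [hu0, hq0]
    right
    rw [show ((0 : Euc n), (0:ℝ)) = 0 from rfl]
    simp [hu0, hq0]
  have hp : 0 < ‖x‖ ^ 2 := by positivity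
  rw [abs_mul, Real.mul_rpow (abs_nonneg _) (abs_nonneg _), abs_of_pos (Real.rpow_pos_of_pos hp _),
    ← Real.rpow_mul hp.le]
  congr 1
  · generalize ‖x‖ ^ 2 = t at hp
    rw [← Real.rpow_natCast, Real.inv_rpow hp.le, ← Real.rpow_neg hp.le]
    congr 1
    linarith
  · simp

lemma kel_tr2 {n : ℕ} (hn : 1 ≤ n) {m s : ℝ} (hm : m = n - 2 * s) {u : Euc n × ℝ → ℝ} (hu0 : u 0 = 0) :
    ∫ x : Euc n, (kel m u (x, 0)) ^ 2 = ∫ x : Euc n, (‖x‖ ^ 2) ^ (-(2 * s)) * (u (x, 0)) ^ 2 := by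
  rw [← inv_vol hn (fun x => (‖x‖^2)^(-(2*s)) * u (x,0)^2)]
  refine integral_congr_ae (Eventually.of_forall fun x => ?_)
  have e : nq ((x, 0) : Euc n × ℝ) = ‖x‖ ^ 2 := by simp [nq_eq]
  simp only [kel, e]
  by_cases hx : x = 0
  · subst hx
    simp [hu0]
    omega
  have hp : 0 < ‖x‖ ^ 2 := by positivity
  have e2 : ‖(‖x‖ ^ 2)⁻¹ • x‖ ^ 2 = (‖x‖ ^ 2)⁻¹ := by
    rw [norm_smul, mul_pow, Real.norm_eq_abs, sq_abs]; field_simp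
  rw [e2, mul_pow, ← mul_assoc]
  congr 1
  · clear e e2
    generalize ‖x‖ ^ 2 = t at hp
    rw [← Real.rpow_natCast, ← Real.rpow_natCast, ← Real.rpow_add (by positivity),
      Real.inv_rpow hp.le, ← Real.rpow_neg hp.le, ← Real.rpow_mul hp.le, hm]
    congr 1
    push_cast
    ring
  · simp

/-- trace functional -/
def NN (n : ℕ) (s : ℝ) (u : Euc n × ℝ → ℝ) : ℝ :=
  ∫ x : Euc n, |u (x, 0)| ^ (2*(n:ℝ) / ((n:ℝ) - 2*s))

lemma Tst.tr_supp {n : ℕ} {u : Euc n × ℝ → ℝ} (h : Tst n u) : HasCompactSupport (fun x : Euc n => u (x, 0)) := by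
  have hc : IsClosedEmbedding (fun x : Euc n => (x, (0:ℝ))) := by
    refine IsClosedEmbedding.of_continuous_injective_isClosedMap (by fun_prop) (fun a b h => by simpa using h) ?_
    exact isClosedMap_prodMk_right (0:ℝ)
  exact h.2.comp_isClosedEmbedding hc

lemma Tst.tr_cont {n : ℕ} {u : Euc n × ℝ → ℝ} (h : Tst n u) : Continuous (fun x : Euc n => u (x, 0)) := by
  have := h.1.continuous
  fun_prop

lemma Tst.tr_pow_cont {n : ℕ} {u : Euc n × ℝ → ℝ} (h : Tst n u) {q : ℝ} (hq : 0 < q) :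
    Continuous (fun x : Euc n => |u (x, 0)| ^ q) :=
  (h.tr_cont.abs).rpow_const (fun _ => Or.inr hq.le)

lemma Tst.tr_pow_supp {n : ℕ} {u : Euc n × ℝ → ℝ} (h : Tst n u) {q : ℝ} (hq : 0 < q) :
    HasCompactSupport (fun x : Euc n => |u (x, 0)| ^ q) := by
  refine h.tr_supp.mono ?_
  intro x hx h0
  exact hx (by simp only [h0]; simp [hq.ne'])

lemma Tst.tr_pow_int {n : ℕ} {u : Euc n × ℝ → ℝ} (h : Tst n u) {q : ℝ} (hq : 0 < q) :
    Integrable (fun x : Euc n => |u (x, 0)| ^ q) :=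
  (h.tr_pow_cont hq).integrable_of_hasCompactSupport (h.tr_pow_supp hq)

lemma q_pos {n : ℕ} (hn : 1 ≤ n) {s : ℝ} (hns : 2 * s < (n:ℝ)) : 0 < 2*(n:ℝ) / ((n:ℝ) - 2*s) := by
  have : (1:ℝ) ≤ n := by exact_mod_cast hn
  apply div_pos <;> linarith

lemma NN_nonneg {n : ℕ} {s : ℝ} (u : Euc n × ℝ → ℝ) : 0 ≤ NN n s u :=
  integral_nonneg fun x => by positivity

lemma NN_pos {n : ℕ} (hn : 1 ≤ n) {s : ℝ} (hns : 2 * s < (n:ℝ)) {u : Euc n × ℝ → ℝ} (h : Tst n u)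
    {x : Euc n} (hx : u (x, 0) ≠ 0) : 0 < NN n s u := by
  have hq := q_pos hn hns
  refine (h.tr_pow_cont hq).integral_pos_of_hasCompactSupport_nonneg_nonzero (h.tr_pow_supp hq)
    (fun x => by positivity) (x := x) ?_
  have : 0 < |u (x,0)| := abs_pos.2 hx
  positivity

lemma exists_tst {n : ℕ} {g : Euc n → ℝ → ℝ} (hg : ContDiff ℝ (⊤ : ℕ∞) (fun p : Euc n × ℝ => g p.1 p.2))
    (hc : IsCompact (closure {p : Euc n × ℝ | 0 ≤ p.2 ∧ g p.1 p.2 ≠ 0})) :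
    ∃ u, Tst n u ∧ ∀ X : Euc n × ℝ, 0 ≤ X.2 → u X = g X.1 X.2 := by
  obtain ⟨R0, hR0⟩ := hc.isBounded.subset_closedBall (0 : Euc n × ℝ)
  set R := max R0 1
  have hR : 0 < R := lt_of_lt_of_le one_pos (le_max_right _ _)
  let φ : ContDiffBump (0 : Euc n × ℝ) := ⟨R, R + 1, hR, by linarith⟩
  refine ⟨fun X => φ X * g X.1 X.2, ⟨φ.contDiff.mul hg, φ.hasCompactSupport.mul_right⟩, ?_⟩
  intro X hX
  by_cases h : g X.1 X.2 = 0
  · simp [h]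
  · have : X ∈ Metric.closedBall (0 : Euc n × ℝ) R :=
      Metric.closedBall_subset_closedBall (le_max_left _ _) (hR0 (subset_closure ⟨hX, h⟩))
    simp only
    rw [φ.one_of_mem_closedBall this, one_mul]

lemma iter_En {n : ℕ} {s : ℝ} (hs : s ∈ Ioo (0:ℝ) 1) {g : Euc n → ℝ → ℝ} {u : Euc n × ℝ → ℝ} (hu : Tst n u)
    (h : ∀ X : Euc n × ℝ, 0 ≤ X.2 → u X = g X.1 X.2)
    (hg : ContDiff ℝ (⊤ : ℕ∞) (fun p : Euc n × ℝ => g p.1 p.2)) :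
    (∫ x : Euc n, ∫ y in Ioi (0:ℝ),
              y ^ (1 - 2*s) * ((∑ i, (pdX n g i x y) ^ 2) + (pdY n g x y) ^ 2)) = En n s u := by
  unfold En
  rw [integral_mu (hu.int_gsq hs)]
  refine integral_congr_ae (Eventually.of_forall fun x => ?_)
  refine setIntegral_congr_fun measurableSet_Ioi fun y hy => ?_
  have hd : DifferentiableAt ℝ (fun p : Euc n × ℝ => g p.1 p.2) (x, y) := hg.differentiable (by simp) _
  simp only [pdX_eq hd, pdY_eq hd, gsq]
  have he : u =ᶠ[𝓝 (x, y)] (fun p : Euc n × ℝ => g p.1 p.2) := by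
    have : {X : Euc n × ℝ | 0 < X.2} ∈ 𝓝 (x, y) := (isOpen_lt continuous_const continuous_snd).mem_nhds hy
    filter_upwards [this] with X hX
    exact h X (le_of_lt hX)
  rw [he.fderiv_eq]

lemma K_bdd (n : ℕ) (s : ℝ) : ∀ r ∈ KQuotSet n s, 0 ≤ r := by
  rintro r ⟨g, -, -, -, rfl⟩
  refine div_nonneg ?_ ?_
  · refine integral_nonneg fun x => ?_
    refine setIntegral_nonneg measurableSet_Ioi fun y hy => ?_
    have : 0 ≤ y ^ (1 - 2*s) := Real.rpow_nonneg (le_of_lt hy) _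
    positivity
  · refine Real.rpow_nonneg (integral_nonneg fun x => ?_) _
    positivity

lemma K_nonneg (n : ℕ) (s : ℝ) : 0 ≤ sInf (KQuotSet n s) := Real.sInf_nonneg (K_bdd n s)

lemma K_ne (n : ℕ) (s : ℝ) : (KQuotSet n s).Nonempty := by
  let φ : ContDiffBump (0 : Euc n × ℝ) := ⟨1, 2, one_pos, by norm_num⟩
  refine ⟨_, fun x y => φ (x, y), φ.contDiff, ?_, ⟨0, ?_⟩, rfl⟩
  · refine φ.hasCompactSupport.isCompact.of_isClosed_subset isClosed_closure ?_
    exact closure_mono fun p hp => hp.2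
  · have : φ ((0 : Euc n), (0:ℝ)) = 1 := φ.one_of_mem_closedBall (by simpa using φ.rIn_pos.le)
    simp only [this]; exact one_ne_zero

lemma smul_En {n : ℕ} {s : ℝ} {u : Euc n × ℝ → ℝ} (h : Tst n u) (c : ℝ) :
    En n s (fun X => c * u X) = c ^ 2 * En n s u := by
  unfold En
  rw [← integral_const_mul]
  congr 1; ext X
  unfold gsq
  have : fderiv ℝ (fun X => c * u X) X = c • fderiv ℝ u X := fderiv_const_mul (h.diff X) c
  simp only [this, _root_.smul_apply, smul_eq_mul, mul_pow]
  rw [← Finset.mul_sum]; ring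

lemma Tst.smul {n : ℕ} {u : Euc n × ℝ → ℝ} (h : Tst n u) (c : ℝ) : Tst n (fun X => c * u X) :=
  ⟨contDiff_const.mul h.1, h.2.mul_left⟩

lemma smul_NN {n : ℕ} {s : ℝ} (u : Euc n × ℝ → ℝ) {c : ℝ} (hc : 0 ≤ c) :
    NN n s (fun X => c * u X) = c ^ (2*(n:ℝ) / ((n:ℝ) - 2*s)) * NN n s u := by
  unfold NN
  rw [← integral_const_mul]
  congr 1; ext x
  rw [abs_mul, abs_of_nonneg hc, Real.mul_rpow hc (abs_nonneg _)]

lemma step0 {n : ℕ} (hn : 1 ≤ n) {s : ℝ} (hs : s ∈ Ioo (0:ℝ) 1) (hns : 2 * s < (n:ℝ)) {η : ℝ} (hη : 0 < η) :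
    ∃ u, Tst n u ∧ NN n s u = 1 ∧ En n s u < sInf (KQuotSet n s) + η := by
  obtain ⟨r, ⟨g, hg, hc, ⟨x, hx⟩, hr⟩, hlt⟩ := exists_lt_of_csInf_lt (K_ne n s) (lt_add_of_pos_right (sInf (KQuotSet n s)) hη)
  obtain ⟨u, hu, hug⟩ := exists_tst hg hc
  rw [iter_En hs hu hug hg] at hr
  have e : (∫ x : Euc n, |g x 0| ^ (2*(n:ℝ) / ((n:ℝ) - 2*s))) = NN n s u := by
    unfold NN; congr 1; ext x; rw [hug (x, 0) le_rfl]
  rw [e] at hr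
  have hN : 0 < NN n s u := NN_pos hn hns hu (x := x) (by rw [hug (x, 0) le_rfl]; exact hx)
  have h1 : (1:ℝ) ≤ n := by exact_mod_cast hn
  have hm : 0 < (n:ℝ) - 2 * s := by linarith
  set c := NN n s u ^ (-(((n:ℝ) - 2*s) / (2*n))) with hcdef
  have hc0 : 0 < c := Real.rpow_pos_of_pos hN _
  refine ⟨fun X => c * u X, hu.smul c, ?_, ?_⟩
  · rw [smul_NN u hc0.le, hcdef, ← Real.rpow_mul hN.le]
    have : -(((n:ℝ) - 2*s) / (2*n)) * (2*(n:ℝ) / ((n:ℝ) - 2*s)) = -1 := by field_simp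
    rw [this, Real.rpow_neg_one, inv_mul_cancel₀ hN.ne']
  · rw [smul_En hu]
    have : c ^ 2 * En n s u = r := by
      rw [hr, hcdef, ← Real.rpow_natCast, ← Real.rpow_mul hN.le, div_eq_mul_inv (En n s u), ← Real.rpow_neg hN.le, mul_comm]
      congr 2
      push_cast; field_simp
    rw [this]; exact hlt

open scoped ENNReal

lemma lin_sq_le {n : ℕ} (u : Euc n × ℝ → ℝ) (X V : Euc n × ℝ) :
    (fderiv ℝ u X V) ^ 2 ≤ nq V * gsq n u X := by
  rw [lin_decomp, nq_sum]
  unfold gsq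
  set a := fun i : Fin n => fderiv ℝ u X (EuclideanSpace.single i 1, 0)
  set b := fderiv ℝ u X (0, 1)
  have h := Finset.sum_mul_sq_le_sq_mul_sq Finset.univ (fun i => V.1 i) a
  set P := ∑ i, V.1 i * a i
  set Q := ∑ i, V.1 i ^ 2
  set R := ∑ i, a i ^ 2
  have hQ : 0 ≤ Q := Finset.sum_nonneg fun i _ => sq_nonneg _
  have hR : 0 ≤ R := Finset.sum_nonneg fun i _ => sq_nonneg _
  have h2 : 2 * P * (V.2 * b) ≤ Q * b ^ 2 + V.2 ^ 2 * R := by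
    have h3 : (2 * P * (V.2 * b)) ^ 2 ≤ (Q * b ^ 2 + V.2 ^ 2 * R) ^ 2 := by
      have : P ^ 2 * (V.2 * b) ^ 2 ≤ Q * R * (V.2 * b) ^ 2 := mul_le_mul_of_nonneg_right h (sq_nonneg _)
      nlinarith [sq_nonneg (Q * b ^ 2 - V.2 ^ 2 * R)]
    exact le_of_abs_le (abs_le_of_sq_le_sq h3 (by positivity))
  change (P + V.2 * b) ^ 2 ≤ (Q + V.2 ^ 2) * (R + b ^ 2)
  nlinarith

lemma wtl (s : ℝ) {H : ℝ → ℝ≥0∞} (hH : Measurable H) :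
    ∫⁻ t, H t ∂(wt s) = ∫⁻ t in Ioi (0:ℝ), ENNReal.ofReal (t ^ (1 - 2*s)) * H t := by
  unfold wt
  rw [lintegral_withDensity_eq_lintegral_mul _ (by fun_prop) hH]
  rfl

lemma lsc {n : ℕ} {ρ : ℝ} (hρ : 0 < ρ) (x : Euc n) (f : Euc n → ℝ≥0∞) :
    ∫⁻ e, f (x + ρ • e) = ENNReal.ofReal ((ρ ^ n)⁻¹) * ∫⁻ z, f z := by
  have h1 := Measure.map_addHaar_smul (volume : Measure (Euc n)) hρ.ne'
  have h2 : ∫⁻ e, f (x + ρ • e) = ∫⁻ z, f (x + z) ∂(Measure.map (fun e : Euc n => ρ • e) volume) := by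
    have := ((Homeomorph.smulOfNeZero (α := Euc n) ρ hρ.ne').measurableEmbedding.lintegral_map (μ := volume) (fun z => f (x + z)))
    exact this.symm
  rw [h2, h1, lintegral_smul_measure, lintegral_add_left_eq_self (fun z => f z) x, smul_eq_mul,
    finrank_euclideanSpace, Fintype.card_fin, abs_of_pos (by positivity)]

lemma ftc_bound {f f' c H : ℝ → ℝ} (hf : ∀ t, HasDerivAt f (f' t) t) (hf' : Continuous f')
    {ρ : ℝ} (hρ : 0 < ρ) (hc : ∀ t, 0 < t → 0 < c t) (hcm : Measurable c) (hH : ∀ t, f' t ^ 2 ≤ 2 * H t) :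
    ‖f ρ - f 0‖ₑ ≤ (∫⁻ t in Ioc 0 ρ, ENNReal.ofReal (c t * H t)) + ∫⁻ t in Ioc 0 ρ, ENNReal.ofReal ((c t)⁻¹) := by
  have h := intervalIntegral.integral_eq_sub_of_hasDerivAt (a := 0) (b := ρ) (f := f) (f' := f') (fun t _ => hf t)
    (hf'.intervalIntegrable _ _)
  rw [← h, intervalIntegral.integral_of_le hρ.le]
  refine (enorm_integral_le_lintegral_enorm _).trans ?_
  rw [← lintegral_add_right _ (by fun_prop)]
  refine setLIntegral_mono' measurableSet_Ioc fun t ht => ?_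
  have hct := hc t ht.1
  have hH0 : 0 ≤ H t := by nlinarith [hH t, sq_nonneg (f' t)]
  rw [← ENNReal.ofReal_add (by positivity) (by positivity), ← ofReal_norm_eq_enorm]
  refine ENNReal.ofReal_le_ofReal ?_
  rw [Real.norm_eq_abs]
  refine abs_le_of_sq_le_sq ?_ (by positivity)
  have : (c t * H t + (c t)⁻¹) ^ 2 = (c t * H t - (c t)⁻¹) ^ 2 + 4 * H t := by field_simp; ring
  nlinarith [hH t, sq_nonneg (c t * H t - (c t)⁻¹)]

lemma lpow {A b ρ : ℝ} (hA : 0 ≤ A) (hb : 0 < b) (hρ : 0 < ρ) :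
    ∫⁻ t in Ioc 0 ρ, ENNReal.ofReal (A * t ^ (b - 1)) = ENNReal.ofReal (A * (ρ ^ b / b)) := by
  rw [← ofReal_integral_eq_lintegral_ofReal]
  · rw [integral_const_mul, ← intervalIntegral.integral_of_le hρ.le, integral_rpow (Or.inl (by linarith))]
    simp [hb.ne']
  · refine Integrable.const_mul ?_ A
    have := intervalIntegral.intervalIntegrable_rpow' (a := 0) (b := ρ) (r := b - 1) (by linarith)
    rwa [intervalIntegrable_iff_integrableOn_Ioc_of_le hρ.le] at this
  · filter_upwards [ae_restrict_mem measurableSet_Ioc] with t ht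
    have := Real.rpow_nonneg ht.1.le (b - 1)
    positivity

/-- up part -/
def Gu (n : ℕ) (s : ℝ) (u : Euc n × ℝ → ℝ) (x : Euc n) : ℝ≥0∞ :=
  ∫⁻ e in Metric.ball (0 : Euc n) 1, ∫⁻ t, ENNReal.ofReal (gsq n u (x + t • e, t)) ∂(wt s)

/-- down part -/
def Gd (n : ℕ) (s : ℝ) (u : Euc n × ℝ → ℝ) (x : Euc n) : ℝ≥0∞ :=
  ∫⁻ z, ∫⁻ t, ENNReal.ofReal (t ^ s * (t + ‖z - x‖) ^ (-((n:ℝ) + s))) *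
    ENNReal.ofReal (gsq n u (z, t)) ∂(wt s)

lemma up_bound {n : ℕ} {s : ℝ} (hs : s ∈ Ioo (0:ℝ) 1) {u : Euc n × ℝ → ℝ} (h : Tst n u) (x e : Euc n)
    (he : ‖e‖ < 1) {ρ κ : ℝ} (hρ : 0 < ρ) (hκ : 0 < κ) :
    ‖u (x + ρ • e, ρ) - u (x, 0)‖ₑ ≤ ENNReal.ofReal κ * (∫⁻ t, ENNReal.ofReal (gsq n u (x + t • e, t)) ∂(wt s))
      + ENNReal.ofReal (κ⁻¹ * (ρ ^ (2*s) / (2 * s))) := by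
  have hg := h.cont_gsq
  have hd : ∀ t : ℝ, HasDerivAt (fun t : ℝ => u (x + t • e, t)) (fderiv ℝ u (x + t • e, t) (e, 1)) t := by
    intro t
    have h1 : HasDerivAt (fun t : ℝ => (x + t • e, t)) (e, (1:ℝ)) t := by
      refine HasDerivAt.prodMk ?_ (hasDerivAt_id t)
      simpa using ((hasDerivAt_id t).smul_const e).const_add x
    exact HasFDerivAt.comp_hasDerivAt (f := fun t : ℝ => (x + t • e, t)) t (h.diff (x + t • e, t)).hasFDerivAt h1
  have hcf := h.cont_fderiv
  have key := ftc_bound hd (by fun_prop) hρ (c := fun t => κ * t ^ (1 - 2*s)) (fun t ht => by positivity)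
    (by fun_prop) (H := fun t => gsq n u (x + t • e, t)) (fun t => by
      refine (lin_sq_le u _ _).trans ?_
      refine mul_le_mul_of_nonneg_right ?_ (gsq_nonneg _ _)
      rw [nq_eq]; simp only; nlinarith [norm_nonneg e])
  simp only [zero_smul, add_zero] at key
  refine key.trans (add_le_add ?_ (le_of_eq ?_))
  · rw [wtl s (by fun_prop), ← lintegral_const_mul' _ _ ENNReal.ofReal_ne_top]
    refine (lintegral_mono_set (fun t (ht : t ∈ Ioc 0 ρ) => ht.1)).trans' ?_
    refine setLIntegral_mono' measurableSet_Ioc fun t ht => ?_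
    rw [mul_assoc, ENNReal.ofReal_mul hκ.le, ENNReal.ofReal_mul (Real.rpow_nonneg ht.1.le _)]
  · rw [← lpow (by positivity) (by linarith [hs.1]) hρ]
    refine setLIntegral_congr_fun measurableSet_Ioc fun t ht => ?_
    rw [mul_inv, ← Real.rpow_neg ht.1.le]
    congr 3; ring

lemma down_bound {n : ℕ} {s : ℝ} (hs : s ∈ Ioo (0:ℝ) 1) {u : Euc n × ℝ → ℝ} (h : Tst n u) (z : Euc n)
    {ρ κ : ℝ} (hρ : 0 < ρ) (hκ : 0 < κ) :
    ‖u (z, ρ) - u (z, 0)‖ₑ ≤ ENNReal.ofReal κ *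
       (∫⁻ t in Iic ρ, ENNReal.ofReal ((t / ρ) ^ s) * ENNReal.ofReal (gsq n u (z, t)) ∂(wt s))
      + ENNReal.ofReal (κ⁻¹ * (ρ ^ (2*s) / s)) := by
  have hg := h.cont_gsq
  have hs0 := hs.1
  have hd : ∀ t : ℝ, HasDerivAt (fun t : ℝ => u (z, t)) (fderiv ℝ u (z, t) (0, 1)) t := by
    intro t
    have h1 : HasDerivAt (fun t : ℝ => (z, t)) ((0 : Euc n), (1:ℝ)) t :=
      HasDerivAt.prodMk (hasDerivAt_const _ _) (hasDerivAt_id t)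
    exact (h.diff (z, t)).hasFDerivAt.comp_hasDerivAt t h1
  have hcf := h.cont_fderiv
  have key := ftc_bound hd (by fun_prop) hρ (c := fun t => κ * t ^ (1 - 2*s) * (t / ρ) ^ s) (fun t ht => by positivity)
    (by fun_prop) (H := fun t => gsq n u (z, t)) (fun t => by
      refine (lin_sq_le u _ _).trans ?_
      refine mul_le_mul_of_nonneg_right ?_ (gsq_nonneg _ _)
      rw [nq_eq]; simp)
  refine key.trans (add_le_add ?_ (le_of_eq ?_))
  · rw [← lintegral_indicator measurableSet_Iic, wtl s (by
      refine Measurable.indicator ?_ measurableSet_Iic; fun_prop), ← lintegral_const_mul' _ _ ENNReal.ofReal_ne_top]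
    refine (lintegral_mono_set (fun t (ht : t ∈ Ioc 0 ρ) => ht.1)).trans' ?_
    refine setLIntegral_mono' measurableSet_Ioc fun t ht => ?_
    have ht0 := ht.1
    rw [indicator_of_mem (show t ∈ Iic ρ from ht.2), ← ENNReal.ofReal_mul (by positivity),
      ← ENNReal.ofReal_mul (by positivity), ← ENNReal.ofReal_mul (by positivity)]
    refine le_of_eq ?_
    congr 1; ring
  · have : κ⁻¹ * (ρ ^ (2*s) / s) = (κ⁻¹ * ρ ^ s) * (ρ ^ s / s) := by
      rw [two_mul, Real.rpow_add hρ]; ring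
    rw [this, ← lpow (by positivity) hs0 hρ]
    refine setLIntegral_congr_fun measurableSet_Ioc fun t ht => ?_
    have ht0 := ht.1
    congr 1
    rw [Real.div_rpow ht0.le hρ.le, mul_inv, mul_inv, inv_div, ← Real.rpow_neg ht0.le, mul_assoc, mul_assoc]
    congr 1
    rw [div_eq_mul_inv, ← Real.rpow_neg ht0.le, mul_left_comm, ← Real.rpow_add ht0]
    congr 2; ring

open scoped ENNReal

lemma down_kernel {n : ℕ} {s : ℝ} (hs : s ∈ Ioo (0:ℝ) 1) {u : Euc n × ℝ → ℝ} (h : Tst n u) (x : Euc n)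
    {ρ : ℝ} (hρ : 0 < ρ) :
    ∫⁻ e in Metric.ball (0 : Euc n) 1,
       (∫⁻ t in Iic ρ, ENNReal.ofReal ((t / ρ) ^ s) * ENNReal.ofReal (gsq n u (x + ρ • e, t)) ∂(wt s))
      ≤ ENNReal.ofReal (2 ^ ((n:ℝ) + s)) * Gd n s u x := by
  set f : Euc n → ℝ≥0∞ := fun z => ∫⁻ t in Iic ρ, ENNReal.ofReal ((t / ρ) ^ s) * ENNReal.ofReal (gsq n u (z, t)) ∂(wt s)
  have e1 : ∫⁻ e in Metric.ball (0 : Euc n) 1, f (x + ρ • e) = ∫⁻ e, (Metric.ball x ρ).indicator f (x + ρ • e) := by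
    rw [← lintegral_indicator measurableSet_ball]
    congr 1; ext e
    by_cases he : ‖e‖ < 1
    · rw [indicator_of_mem (by simpa using he), indicator_of_mem]
      simp only [mem_ball_iff_norm, add_sub_cancel_left, norm_smul, Real.norm_eq_abs, abs_of_pos hρ]
      nlinarith
    · rw [indicator_of_notMem (by simpa using he), indicator_of_notMem]
      simp only [mem_ball_iff_norm, add_sub_cancel_left, norm_smul, Real.norm_eq_abs, abs_of_pos hρ]
      push Not at he ⊢
      nlinarith
  change ∫⁻ e in Metric.ball (0 : Euc n) 1, f (x + ρ • e) ≤ _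
  rw [e1, lsc hρ, lintegral_indicator measurableSet_ball, Gd, ← lintegral_const_mul' _ _ ENNReal.ofReal_ne_top,
    ← lintegral_const_mul' _ _ ENNReal.ofReal_ne_top]
  refine (setLIntegral_mono' measurableSet_ball fun z hz => ?_).trans (setLIntegral_le_lintegral _ _)
  simp only [f]
  rw [← lintegral_const_mul' _ _ ENNReal.ofReal_ne_top, ← lintegral_const_mul' _ _ ENNReal.ofReal_ne_top]
  have hp : ∀ᵐ t ∂(wt s), 0 < t := by
    unfold wt
    refine (withDensity_absolutelyContinuous _ _).ae_le ?_
    exact ae_restrict_mem measurableSet_Ioi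
  refine (lintegral_mono_ae ?_).trans (setLIntegral_le_lintegral (Iic ρ) _)
  filter_upwards [ae_restrict_mem measurableSet_Iic, ae_restrict_of_ae hp] with t ht1 ht
  rw [← mul_assoc, ← mul_assoc]
  refine mul_le_mul' ?_ le_rfl
  have hz' : ‖z - x‖ < ρ := by rwa [mem_ball_iff_norm] at hz
  have ht1' : t ≤ ρ := ht1
  rw [← ENNReal.ofReal_mul (by positivity), ← ENNReal.ofReal_mul (by positivity)]
  refine ENNReal.ofReal_le_ofReal ?_
  have hb : 0 < t + ‖z - x‖ := by positivity
  have h1 : (2 * ρ) ^ (-((n:ℝ) + s)) ≤ (t + ‖z - x‖) ^ (-((n:ℝ) + s)) := by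
    refine Real.rpow_le_rpow_of_nonpos hb (by linarith) ?_
    have := hs.1
    have : (0:ℝ) ≤ n := Nat.cast_nonneg n
    linarith
  have h2 : (ρ ^ n)⁻¹ * (t / ρ) ^ s = 2 ^ ((n:ℝ) + s) * (t ^ s * (2 * ρ) ^ (-((n:ℝ) + s))) := by
    rw [Real.div_rpow ht.le hρ.le, Real.mul_rpow (by norm_num) hρ.le, Real.rpow_neg (by norm_num : (0:ℝ) ≤ 2),
      Real.rpow_neg hρ.le, Real.rpow_add hρ, Real.rpow_natCast]
    have : (0:ℝ) < 2 ^ ((n:ℝ) + s) := by positivity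
    field_simp
  rw [h2]
  gcongr

lemma pw {n : ℕ} {s : ℝ} (hs : s ∈ Ioo (0:ℝ) 1) {u : Euc n × ℝ → ℝ} (h : Tst n u) (x : Euc n)
    {ρ κ : ℝ} (hρ : 0 < ρ) (hκ : 0 < κ) :
    ‖u (x, 0)‖ₑ * volume (Metric.ball (0 : Euc n) 1) ≤
      (∫⁻ e in Metric.ball (0 : Euc n) 1, ‖u (x + ρ • e, 0)‖ₑ) +
      ENNReal.ofReal κ * (Gu n s u x + ENNReal.ofReal (2 ^ ((n:ℝ) + s)) * Gd n s u x) +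
      ENNReal.ofReal (κ⁻¹ * (ρ ^ (2*s) / (2 * s)) + κ⁻¹ * (ρ ^ (2*s) / s)) * volume (Metric.ball (0 : Euc n) 1) := by
  have hg := h.cont_gsq
  have hs0 := hs.1
  have huc := h.1.continuous
  have hum : Measurable (fun e : Euc n => u (x + ρ • e, 0)) :=
    Continuous.measurable (by fun_prop)
  refine le_trans ?_ (add_le_add_left (add_le_add_right (mul_le_mul_right (add_le_add_right (down_kernel hs h x hρ) _) _) _) _)
  rw [Gu, mul_add, ← lintegral_const_mul' _ _ ENNReal.ofReal_ne_top, ← lintegral_const_mul' _ _ ENNReal.ofReal_ne_top,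
    ← lintegral_add_left, ← lintegral_add_left hum.enorm, ← setLIntegral_const, ← setLIntegral_const,
    ← lintegral_add_right _ (by fun_prop)]
  · refine setLIntegral_mono' measurableSet_ball fun e he => ?_
    have he' : ‖e‖ < 1 := by simpa using he
    have h1 := up_bound hs h x e he' hρ hκ
    have h2 := down_bound hs h (x + ρ • e) hρ hκ
    have h3 : u (x, 0) = u (x + ρ • e, 0) + ((u (x + ρ • e, ρ) - u (x + ρ • e, 0)) - (u (x + ρ • e, ρ) - u (x, 0))) := by ring
    calc ‖u (x, 0)‖ₑ ≤ ‖u (x + ρ • e, 0)‖ₑ + (‖u (x + ρ • e, ρ) - u (x + ρ • e, 0)‖ₑ + ‖u (x + ρ • e, ρ) - u (x, 0)‖ₑ) := by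
          conv_lhs => rw [h3]
          exact (enorm_add_le _ _).trans (add_le_add_right (enorm_sub_le) _)
      _ ≤ _ := add_le_add_right (add_le_add h2 h1) _
      _ = _ := by
          rw [ENNReal.ofReal_add (by positivity) (by positivity)]
          ring
  · refine Measurable.const_mul ?_ _
    refine Measurable.lintegral_prod_right' (f := fun p : Euc n × ℝ => ENNReal.ofReal (gsq n u (x + p.2 • p.1, p.2))) ?_
    fun_prop

lemma lint_gsq {n : ℕ} {s : ℝ} (hs : s ∈ Ioo (0:ℝ) 1) {u : Euc n × ℝ → ℝ} (h : Tst n u) :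
    ∫⁻ z, ∫⁻ t, ENNReal.ofReal (gsq n u (z, t)) ∂(wt s) = ENNReal.ofReal (En n s u) := by
  have hg := h.cont_gsq
  unfold En
  rw [ofReal_integral_eq_lintegral_ofReal (h.int_gsq hs) (Eventually.of_forall (gsq_nonneg u)), mu,
    lintegral_prod _ (by fun_prop)]

lemma int_Gu {n : ℕ} {s : ℝ} (hs : s ∈ Ioo (0:ℝ) 1) {u : Euc n × ℝ → ℝ} (h : Tst n u) :
    ∫⁻ x, Gu n s u x = ENNReal.ofReal (En n s u) * volume (Metric.ball (0 : Euc n) 1) := by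
  have hg := h.cont_gsq
  unfold Gu
  rw [lintegral_lintegral_swap]
  · rw [← setLIntegral_const]
    refine lintegral_congr fun e => ?_
    rw [lintegral_lintegral_swap]
    · rw [← lint_gsq hs h, lintegral_lintegral_swap (f := fun z t => ENNReal.ofReal (gsq n u (z, t)))]
      · refine lintegral_congr fun t => ?_
        exact lintegral_add_right_eq_self (fun x => ENNReal.ofReal (gsq n u (x, t))) (t • e)
      · unfold Function.uncurry; fun_prop
    · unfold Function.uncurry; fun_prop
  · refine Measurable.aemeasurable ?_
    refine Measurable.lintegral_prod_right' (f := fun p : (Euc n × Euc n) × ℝ => ENNReal.ofReal (gsq n u (p.1.1 + p.2 • p.1.2, p.2))) ?_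
    fun_prop

/-- kernel mass -/
def k0 (n : ℕ) (s : ℝ) : ℝ≥0∞ := ∫⁻ x : Euc n, ENNReal.ofReal ((1 + ‖x‖) ^ (-((n:ℝ) + s)))

lemma k0_lt {n : ℕ} {s : ℝ} (hs : s ∈ Ioo (0:ℝ) 1) : k0 n s < ⊤ := by
  refine finite_integral_one_add_norm ?_
  simp [hs.1]

lemma ker_int {n : ℕ} {s : ℝ} (z : Euc n) {t : ℝ} (ht : 0 < t) :
    ∫⁻ x : Euc n, ENNReal.ofReal (t ^ s * (t + ‖z - x‖) ^ (-((n:ℝ) + s))) = k0 n s := by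
  have h := lsc ht z (fun x : Euc n => ENNReal.ofReal (t ^ s * (t + ‖z - x‖) ^ (-((n:ℝ) + s))))
  have e : ∀ e : Euc n, ENNReal.ofReal (t ^ s * (t + ‖z - (z + t • e)‖) ^ (-((n:ℝ) + s)))
      = ENNReal.ofReal ((t ^ n)⁻¹) * ENNReal.ofReal ((1 + ‖e‖) ^ (-((n:ℝ) + s))) := by
    intro e
    rw [← ENNReal.ofReal_mul (by positivity)]
    congr 1
    have : t + ‖z - (z + t • e)‖ = t * (1 + ‖e‖) := by
      rw [sub_add_cancel_left, norm_neg, norm_smul, Real.norm_eq_abs, abs_of_pos ht]; ring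
    rw [this, Real.mul_rpow ht.le (by positivity), ← mul_assoc, ← Real.rpow_add ht]
    congr 1
    rw [← Real.rpow_natCast, ← Real.rpow_neg ht.le]
    congr 1; ring
  simp only [e] at h
  rw [lintegral_const_mul' _ _ ENNReal.ofReal_ne_top] at h
  exact ((ENNReal.mul_right_inj (by simp; positivity) ENNReal.ofReal_ne_top).1 h).symm

lemma ae_wt_pos (s : ℝ) : ∀ᵐ t ∂(wt s), 0 < t := by
  unfold wt
  refine (withDensity_absolutelyContinuous _ _).ae_le ?_
  exact ae_restrict_mem measurableSet_Ioi

lemma int_Gd {n : ℕ} {s : ℝ} (hs : s ∈ Ioo (0:ℝ) 1) {u : Euc n × ℝ → ℝ} (h : Tst n u) :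
    ∫⁻ x, Gd n s u x = k0 n s * ENNReal.ofReal (En n s u) := by
  have hg := h.cont_gsq
  unfold Gd
  rw [lintegral_lintegral_swap]
  · rw [← lint_gsq hs h, ← lintegral_const_mul' _ _ (k0_lt hs).ne]
    refine lintegral_congr fun z => ?_
    rw [lintegral_lintegral_swap]
    · rw [← lintegral_const_mul' _ _ (k0_lt hs).ne]
      refine lintegral_congr_ae ?_
      filter_upwards [ae_wt_pos s] with t ht
      rw [lintegral_mul_const' _ _ ENNReal.ofReal_ne_top, ker_int z ht]
    · unfold Function.uncurry; fun_prop
  · refine Measurable.aemeasurable ?_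
    refine Measurable.lintegral_prod_right' (f := fun p : (Euc n × Euc n) × ℝ =>
      ENNReal.ofReal (p.2 ^ s * (p.2 + ‖p.1.2 - p.1.1‖) ^ (-((n:ℝ) + s))) * ENNReal.ofReal (gsq n u (p.1.2, p.2))) ?_
    fun_prop

open scoped ENNReal

lemma meas_Gu {n : ℕ} {s : ℝ} {u : Euc n × ℝ → ℝ} (h : Tst n u) : Measurable (Gu n s u) := by
  have hg := h.cont_gsq
  unfold Gu
  refine Measurable.lintegral_prod_right' (f := fun p : Euc n × Euc n => ∫⁻ t, ENNReal.ofReal (gsq n u (p.1 + t • p.2, t)) ∂(wt s)) ?_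
  refine Measurable.lintegral_prod_right' (f := fun p : (Euc n × Euc n) × ℝ => ENNReal.ofReal (gsq n u (p.1.1 + p.2 • p.1.2, p.2))) ?_
  fun_prop

lemma real_opt {s m q U a ω g : ℝ} (hs : 0 < s) (hm : 0 < m) (hq : q = 2 + 4 * s / m) (hU : 0 < U) (ha : 0 < a)
    (hω : 0 < ω)
    (H : ∀ ρ κ : ℝ, 0 < ρ → 0 < κ → U * ω ≤ a * ρ ^ (-(m/2)) + κ * g + (κ⁻¹ * (ρ ^ (2*s) / (2 * s)) + κ⁻¹ * (ρ ^ (2*s) / s)) * ω) :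
    U ^ q ≤ 12 / (s * ω) * (4 * a / ω) ^ (4 * s / m) * g := by
  set b := 4 * a / (ω * U) with hb
  have hb0 : 0 < b := by positivity
  set ρ := b ^ (2 / m) with hρd
  have hρ : 0 < ρ := by positivity
  set T := ρ ^ (2*s) with hT
  have hT0 : 0 < T := by positivity
  have hTb : T = b ^ (4 * s / m) := by
    rw [hT, hρd, ← Real.rpow_mul hb0.le]; congr 1; field_simp; ring
  have h1 : ρ ^ (-(m/2)) = b⁻¹ := by
    rw [hρd, ← Real.rpow_mul hb0.le, ← Real.rpow_neg_one]; congr 1; field_simp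
  have h2 := H ρ (6 * T / (s * U)) hρ (by positivity)
  rw [h1] at h2
  have e1 : a * b⁻¹ = ω * U / 4 := by rw [hb]; field_simp
  have e2 : ((6 * T / (s * U))⁻¹ * (T / (2 * s)) + (6 * T / (s * U))⁻¹ * (T / s)) * ω = ω * U / 4 := by
    field_simp; ring
  rw [e1, ← hT, e2] at h2
  have h3 : ω * U / 2 ≤ 6 * T / (s * U) * g := by linarith
  have h4 : U ^ 2 ≤ 12 / (s * ω) * T * g := by
    have := mul_le_mul_of_nonneg_left h3 (show 0 ≤ 2 * U / ω by positivity)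
    have e3 : 2 * U / ω * (ω * U / 2) = U ^ 2 := by field_simp
    have e4 : 2 * U / ω * (6 * T / (s * U) * g) = 12 / (s * ω) * T * g := by field_simp; ring
    linarith
  have h5 : T = (4 * a / ω) ^ (4 * s / m) * (U ^ (4 * s / m))⁻¹ := by
    rw [hTb, hb, ← div_div, Real.div_rpow (by positivity) hU.le, div_eq_mul_inv]
  rw [hq, Real.rpow_add hU, Real.rpow_two]
  have hp : 0 < U ^ (4 * s / m) := by positivity
  calc U ^ 2 * U ^ (4 * s / m) ≤ 12 / (s * ω) * T * g * U ^ (4 * s / m) := by gcongr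
    _ = _ := by rw [h5]; field_simp

lemma nonvan {n : ℕ} (hn : 1 ≤ n) {s : ℝ} (hs : s ∈ Ioo (0:ℝ) 1) (hns : 2 * s < (n:ℝ)) :
    ∃ C > 0, ∀ u, Tst n u → ∀ a : ℝ, 0 < a →
      (∀ (x : Euc n) (ρ : ℝ), 0 < ρ → ∫ e in Metric.ball (0 : Euc n) 1, |u (x + ρ • e, 0)| ≤ a * ρ ^ (-(((n:ℝ) - 2*s)/2))) →
      NN n s u ≤ C * a ^ (4 * s / ((n:ℝ) - 2*s)) * En n s u := by
  set m := (n:ℝ) - 2*s with hmd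
  have hm : 0 < m := by linarith
  have hs0 := hs.1
  set ω := (volume (Metric.ball (0 : Euc n) 1)).toReal with hωd
  have hωt : volume (Metric.ball (0 : Euc n) 1) ≠ ⊤ := measure_ball_lt_top.ne
  have hω : 0 < ω := ENNReal.toReal_pos (Metric.measure_ball_pos _ _ one_pos).ne' hωt
  have hωe : volume (Metric.ball (0 : Euc n) 1) = ENNReal.ofReal ω := (ENNReal.ofReal_toReal hωt).symm
  set k := (k0 n s).toReal with hkd
  have hk : 0 ≤ k := ENNReal.toReal_nonneg
  have hke : k0 n s = ENNReal.ofReal k := (ENNReal.ofReal_toReal (k0_lt hs).ne).symm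
  refine ⟨12 / (s * ω) * (4 / ω) ^ (4 * s / m) * (ω + 2 ^ ((n:ℝ) + s) * k), by positivity, ?_⟩
  intro u hu a ha hav
  set q := 2 * (n:ℝ) / m with hqd
  have hq0 : 0 < q := q_pos hn hns
  have hq : q = 2 + 4 * s / m := by rw [hqd]; field_simp; rw [hmd]; ring
  set G : Euc n → ℝ≥0∞ := fun x => Gu n s u x + ENNReal.ofReal (2 ^ ((n:ℝ) + s)) * Gd n s u x with hG
  set D := 12 / (s * ω) * (4 * a / ω) ^ (4 * s / m) with hD
  have hD0 : 0 < D := by positivity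
  have main : ∀ x, ENNReal.ofReal (|u (x, 0)| ^ q) ≤ ENNReal.ofReal D * G x := by
    intro x
    by_cases hU : u (x, 0) = 0
    · simp [hU, hq0.ne']
    by_cases hGt : G x = ⊤
    · rw [hGt, ENNReal.mul_top (by simpa using hD0)]; exact le_top
    have hGe : G x = ENNReal.ofReal (G x).toReal := (ENNReal.ofReal_toReal hGt).symm
    rw [hGe, ← ENNReal.ofReal_mul hD0.le]
    refine ENNReal.ofReal_le_ofReal ?_
    refine real_opt hs0 hm hq (abs_pos.2 hU) ha hω ?_
    intro ρ κ hρ hκ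
    have h := pw hs hu x hρ hκ
    have hintg : IntegrableOn (fun e : Euc n => u (x + ρ • e, 0)) (Metric.ball 0 1) := by
      have hc := hu.1.continuous
      have hc : Continuous (fun e : Euc n => u (x + ρ • e, 0)) := by fun_prop
      exact (hc.continuousOn.integrableOn_compact (isCompact_closedBall 0 1)).mono_set Metric.ball_subset_closedBall
    rw [← ofReal_integral_norm_eq_lintegral_enorm hintg, hωe] at h
    have hg0 : Gu n s u x + ENNReal.ofReal (2 ^ ((n:ℝ) + s)) * Gd n s u x = ENNReal.ofReal (G x).toReal := hGe
    have hav' := hav x ρ hρ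
    simp only [Real.norm_eq_abs] at h
    rw [hg0, ← ofReal_norm_eq_enorm, ← ENNReal.ofReal_mul (by positivity), ← ENNReal.ofReal_mul (by positivity),
      ← ENNReal.ofReal_mul (by positivity), ← ENNReal.ofReal_add (integral_nonneg fun _ => abs_nonneg _) (by positivity),
      ← ENNReal.ofReal_add (add_nonneg (integral_nonneg fun _ => abs_nonneg _) (by positivity)) (by positivity),
      ENNReal.ofReal_le_ofReal_iff (add_nonneg (add_nonneg (integral_nonneg fun _ => abs_nonneg _) (by positivity)) (by positivity))] at h
    rw [Real.norm_eq_abs] at h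
    linarith
  have h1 : ENNReal.ofReal (NN n s u) ≤ ENNReal.ofReal (D * (ω + 2 ^ ((n:ℝ) + s) * k) * En n s u) := by
    unfold NN
    rw [ofReal_integral_eq_lintegral_ofReal (hu.tr_pow_int hq0) (Eventually.of_forall fun x => by positivity)]
    refine (lintegral_mono main).trans (le_of_eq ?_)
    rw [lintegral_const_mul' _ _ ENNReal.ofReal_ne_top, hG, lintegral_add_left (meas_Gu hu),
      lintegral_const_mul' _ _ ENNReal.ofReal_ne_top, int_Gu hs hu, int_Gd hs hu, hωe, hke]
    have hE := En_nonneg (s := s) u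
    rw [← ENNReal.ofReal_mul hE, ← ENNReal.ofReal_mul hk, ← ENNReal.ofReal_mul (by positivity),
      ← ENNReal.ofReal_add (by positivity) (by positivity), ← ENNReal.ofReal_mul hD0.le]
    congr 1; ring
  rw [ENNReal.ofReal_le_ofReal_iff (mul_nonneg (by positivity) (En_nonneg u))] at h1
  refine h1.trans (le_of_eq ?_)
  have : (4 * a / ω) ^ (4 * s / m) = (4 / ω) ^ (4 * s / m) * a ^ (4 * s / m) := by
    rw [← Real.mul_rpow (by positivity) ha.le]; congr 1; ring
  rw [hD, this]; ring

open scoped ENNReal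

lemma sc_NN {n : ℕ} (hn : 1 ≤ n) {s : ℝ} (hns : 2 * s < (n:ℝ)) (u : Euc n × ℝ → ℝ) (b : Euc n) {ρ : ℝ} (hρ : 0 < ρ) :
    NN n s (fun X => ρ ^ (((n:ℝ) - 2*s)/2) * u (ρ • X.1 + b, ρ * X.2)) = NN n s u := by
  have hm : 0 < (n:ℝ) - 2*s := by linarith
  rw [smul_NN (fun X => u (ρ • X.1 + b, ρ * X.2)) (by positivity)]
  unfold NN
  simp only [mul_zero]
  rw [sc_vol b hρ (fun x => |u (x, 0)| ^ (2*(n:ℝ) / ((n:ℝ) - 2*s))), ← Real.rpow_mul hρ.le, ← mul_assoc]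
  have : ((n:ℝ) - 2*s)/2 * (2*(n:ℝ) / ((n:ℝ) - 2*s)) = n := by field_simp
  rw [this, Real.rpow_natCast, mul_inv_cancel₀ (by positivity), one_mul]

lemma step2 {n : ℕ} (hn : 1 ≤ n) {s : ℝ} (hs : s ∈ Ioo (0:ℝ) 1) (hns : 2 * s < (n:ℝ)) {B : ℝ} (hB : 0 < B) :
    ∃ a > 0, ∀ u, Tst n u → NN n s u = 1 → En n s u ≤ B →
      ∃ v, Tst n v ∧ NN n s v = 1 ∧ En n s v = En n s u ∧ a ≤ ∫ x in Metric.ball (0 : Euc n) 1, |v (x, 0)| := by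
  obtain ⟨C, hC, H⟩ := nonvan hn hs hns
  have hm : 0 < (n:ℝ) - 2*s := by linarith
  have hs0 := hs.1
  set p := 4 * s / ((n:ℝ) - 2*s) with hp
  have hp0 : 0 < p := by positivity
  refine ⟨(1 / (2 * C * B)) ^ p⁻¹, by positivity, ?_⟩
  set a := (1 / (2 * C * B)) ^ p⁻¹ with ha
  have ha0 : 0 < a := by positivity
  intro u hu h1 hE
  have hap : a ^ p = 1 / (2 * C * B) := by
    rw [ha, ← Real.rpow_mul (by positivity), inv_mul_cancel₀ hp0.ne', Real.rpow_one]
  have : ∃ (x : Euc n) (ρ : ℝ), 0 < ρ ∧ a * ρ ^ (-(((n:ℝ) - 2*s)/2)) < ∫ e in Metric.ball (0 : Euc n) 1, |u (x + ρ • e, 0)| := by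
    by_contra hcon
    push Not at hcon
    have h2 := H u hu a ha0 hcon
    rw [h1, hap] at h2
    have h3 : C * (1 / (2 * C * B)) * En n s u ≤ C * (1 / (2 * C * B)) * B := by gcongr
    have h4 : C * (1 / (2 * C * B)) * B = 1 / 2 := by field_simp
    linarith
  obtain ⟨x, ρ, hρ, hlt⟩ := this
  refine ⟨fun X => ρ ^ (((n:ℝ) - 2*s)/2) * u (ρ • X.1 + x, ρ * X.2), hu.sc x hρ _, ?_, ?_, ?_⟩
  · rw [sc_NN hn hns u x hρ, h1]
  · rw [sc_En hs hu x hρ, ← Real.rpow_natCast, ← Real.rpow_mul hρ.le]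
    have : ((n:ℝ) - 2*s)/2 * ((2:ℕ):ℝ) = (n:ℝ) - 2*s := by push_cast; ring
    rw [this, mul_inv_cancel₀ (by positivity), one_mul]
  · simp only [mul_zero, abs_mul]
    rw [integral_const_mul, abs_of_pos (by positivity)]
    rw [Real.rpow_neg hρ.le, ← div_eq_mul_inv, div_lt_iff₀ (by positivity)] at hlt
    rw [mul_comm]
    refine hlt.le.trans (le_of_eq ?_)
    congr 1
    refine integral_congr_ae (Eventually.of_forall fun e => ?_)
    simp only [add_comm]

lemma avg_tonelli {n : ℕ} {Y : Type*} [MeasurableSpace Y] (ν : Measure Y) [SFinite ν] {π : Y → Euc n}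
    (hπ : Measurable π) {f : Y → ℝ≥0∞} (hf : Measurable f) {R : ℝ} (hR : 0 < R) :
    ∫⁻ p : Euc n, ∫⁻ X in {X | ‖π X - p‖ ≤ R}, f X ∂ν = volume (Metric.closedBall (0 : Euc n) R) * ∫⁻ X, f X ∂ν := by
  have hS : ∀ p : Euc n, MeasurableSet {X | ‖π X - p‖ ≤ R} := fun p =>
    measurableSet_le (by fun_prop) measurable_const
  have hfin : volume (Metric.closedBall (0 : Euc n) R) ≠ ⊤ := measure_closedBall_lt_top.ne
  simp_rw [← lintegral_indicator (hS _)]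
  rw [lintegral_lintegral_swap]
  · rw [← lintegral_const_mul' _ _ hfin]
    refine lintegral_congr fun X => ?_
    have : (fun p : Euc n => ({X | ‖π X - p‖ ≤ R} : Set Y).indicator f X) = (Metric.closedBall (π X) R).indicator (fun _ => f X) := by
      ext p
      by_cases h : ‖π X - p‖ ≤ R
      · rw [indicator_of_mem (by exact h), indicator_of_mem (by rwa [mem_closedBall_iff_norm, norm_sub_rev])]
      · rw [indicator_of_notMem (by exact h), indicator_of_notMem (by rwa [mem_closedBall_iff_norm, norm_sub_rev])]
    rw [this, lintegral_indicator measurableSet_closedBall, setLIntegral_const, mul_comm,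
      Measure.addHaar_closedBall_center]
  · refine Measurable.aemeasurable ?_
    have hM : MeasurableSet {z : Euc n × Y | ‖π z.2 - z.1‖ ≤ R} := measurableSet_le (by fun_prop) measurable_const
    have : Function.uncurry (fun (p : Euc n) (X : Y) => ({X | ‖π X - p‖ ≤ R} : Set Y).indicator f X) =
      {z : Euc n × Y | ‖π z.2 - z.1‖ ≤ R}.indicator (fun z => f z.2) := by
      ext z; rfl
    rw [this]
    exact (hf.comp measurable_snd).indicator hM

lemma step3a {n : ℕ} (hn : 1 ≤ n) {s : ℝ} (hs : s ∈ Ioo (0:ℝ) 1) (hns : 2 * s < (n:ℝ)) {B : ℝ} (hB : 0 < B) :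
    ∃ a > 0, ∃ C > 0, ∀ r > 0, ∀ u, Tst n u → NN n s u = 1 → En n s u ≤ B →
      ∃ v, Tst n v ∧ NN n s v = 1 ∧ En n s v = En n s u ∧ a ≤ ∫ x in Metric.ball (0 : Euc n) 2, |v (x, 0)| ∧
       ∫⁻ X in {X | ‖X.1‖ ≤ 2 * r}, ENNReal.ofReal (gsq n v X) ∂(mu n s) ≤ ENNReal.ofReal (C * r ^ n) ∧
       ∫⁻ x in Metric.closedBall (0 : Euc n) (2 * r), ENNReal.ofReal (|v (x, 0)| ^ (2*(n:ℝ) / ((n:ℝ) - 2*s))) ≤ ENNReal.ofReal (C * r ^ n) := by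
  obtain ⟨a, ha, H⟩ := step2 hn hs hns hB
  refine ⟨a, ha, 2 * 2 ^ n * (B + 1), by positivity, ?_⟩
  intro r hr u hu hN hE
  obtain ⟨v, hv, hvN, hvE, hva⟩ := H u hu hN hE
  have hq := q_pos hn hns
  set q := 2*(n:ℝ) / ((n:ℝ) - 2*s) with hqd
  have hg := hv.cont_gsq
  have hcq := hv.tr_pow_cont hq
  have hfm : Measurable (fun x : Euc n => ENNReal.ofReal (|v (x, 0)| ^ q)) := hcq.measurable.ennreal_ofReal
  have hgm : Measurable (fun X : Euc n × ℝ => ENNReal.ofReal (gsq n v X)) := hg.measurable.ennreal_ofReal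
  set T1 : Euc n → ℝ≥0∞ := fun p => ∫⁻ X in {X | ‖X.1 - p‖ ≤ 2 * r}, ENNReal.ofReal (gsq n v X) ∂(mu n s) with hT1
  set T3 : Euc n → ℝ≥0∞ := fun p => ∫⁻ x in {x | ‖x - p‖ ≤ 2 * r}, ENNReal.ofReal (|v (x, 0)| ^ q) with hT3
  set ω := volume (Metric.ball (0 : Euc n) 1) with hω
  have hω0 : ω ≠ 0 := (Metric.measure_ball_pos _ _ one_pos).ne'
  have hωt : ω ≠ ⊤ := measure_ball_lt_top.ne
  have hE0 := En_nonneg (s := s) v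
  have i1 : ∫⁻ p, T1 p = volume (Metric.closedBall (0 : Euc n) (2 * r)) * ENNReal.ofReal (En n s v) := by
    rw [hT1, avg_tonelli (mu n s) measurable_fst hgm (by positivity), En,
      ofReal_integral_eq_lintegral_ofReal (hv.int_gsq hs) (Eventually.of_forall (gsq_nonneg v))]
  have i3 : ∫⁻ p, T3 p = volume (Metric.closedBall (0 : Euc n) (2 * r)) * 1 := by
    have ht := avg_tonelli (volume : Measure (Euc n)) (π := fun x => x) measurable_id hfm (R := 2 * r) (by positivity)
    refine Eq.trans ht ?_
    rw [
      ← ofReal_integral_eq_lintegral_ofReal (hv.tr_pow_int hq) (Eventually.of_forall fun x => by positivity)]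
    have : ∫ (x : Euc n), |v (x, 0)| ^ q = 1 := hvN
    rw [this, ENNReal.ofReal_one]
  have hcb : volume (Metric.closedBall (0 : Euc n) (2 * r)) = ENNReal.ofReal ((2 * r) ^ n) * ω := by
    rw [Measure.addHaar_closedBall _ _ (by positivity), finrank_euclideanSpace, Fintype.card_fin]
  have hsel : ∃ p ∈ Metric.ball (0 : Euc n) 1, T1 p + T3 p ≤ ENNReal.ofReal (2 * 2 ^ n * (B + 1) * r ^ n) := by
    by_contra hcon
    push Not at hcon
    have h1 : ENNReal.ofReal (2 * 2 ^ n * (B + 1) * r ^ n) * ω ≤ ENNReal.ofReal ((2 * r) ^ n * (B + 1)) * ω := by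
      calc ENNReal.ofReal (2 * 2 ^ n * (B + 1) * r ^ n) * ω = ∫⁻ p in Metric.ball (0 : Euc n) 1, ENNReal.ofReal (2 * 2 ^ n * (B + 1) * r ^ n) := by
            rw [setLIntegral_const]
        _ ≤ ∫⁻ p in Metric.ball (0 : Euc n) 1, (T1 p + T3 p) :=
            setLIntegral_mono' measurableSet_ball fun p hp => (hcon p hp).le
        _ ≤ ∫⁻ p, (T1 p + T3 p) := setLIntegral_le_lintegral _ _
        _ ≤ ENNReal.ofReal ((2 * r) ^ n * (B + 1)) * ω := by
            rw [lintegral_add_right, i1, i3, ← mul_add, hcb, ← ENNReal.ofReal_one, ← ENNReal.ofReal_add hE0 zero_le_one,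
              ENNReal.ofReal_mul (by positivity), mul_right_comm]
            · gcongr
              linarith
            · have hM : MeasurableSet {z : Euc n × Euc n | ‖z.2 - z.1‖ ≤ 2 * r} := measurableSet_le (by fun_prop) measurable_const
              have hS : ∀ p : Euc n, MeasurableSet {x : Euc n | ‖x - p‖ ≤ 2 * r} := fun p =>
                measurableSet_le (by fun_prop) measurable_const
              simp only [hT3]
              simp_rw [← lintegral_indicator (hS _)]
              refine Measurable.lintegral_prod_right' (f := {z : Euc n × Euc n | ‖z.2 - z.1‖ ≤ 2 * r}.indicator (fun z => ENNReal.ofReal (|v (z.2, 0)| ^ q))) ?_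
              exact (hfm.comp measurable_snd).indicator hM
    rw [ENNReal.mul_le_mul_iff_left hω0 hωt, ENNReal.ofReal_le_ofReal_iff (by positivity), mul_pow] at h1
    have : 0 < 2 ^ n * (B + 1) * r ^ n := by positivity
    nlinarith
  obtain ⟨p, hp, hple⟩ := hsel
  have hp1 : ‖p‖ < 1 := by simpa using hp
  refine ⟨fun X => 1 * v ((1:ℝ) • X.1 + p, 1 * X.2), hv.sc p one_pos 1, ?_, ?_, ?_, ?_, ?_⟩
  · have := sc_NN hn hns v p one_pos
    rw [Real.one_rpow] at this
    rw [this, hvN]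
  · rw [sc_En hs hv p one_pos, ← hvE]; simp
  · simp only [one_mul, one_smul]
    have hintg : IntegrableOn (fun x : Euc n => |v (x, 0)|) (Metric.ball p 2) :=
      (hv.tr_cont.abs.continuousOn.integrableOn_compact (isCompact_closedBall p 2)).mono_set Metric.ball_subset_closedBall
    have e : ∫ x in Metric.ball (0 : Euc n) 2, |v (x + p, 0)| = ∫ x in Metric.ball p 2, |v (x, 0)| := by
      rw [← integral_indicator measurableSet_ball, ← integral_indicator measurableSet_ball,
        ← integral_add_right_eq_self ((Metric.ball p 2).indicator fun x => |v (x, 0)|) p]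
      congr 1; ext x
      simp only [indicator, mem_ball_iff_norm, sub_zero, add_sub_cancel_right]
    rw [e]
    refine hva.trans (setIntegral_mono_set hintg (Eventually.of_forall fun x => abs_nonneg _) ?_)
    refine Eventually.of_forall ?_
    refine Metric.ball_subset_ball' ?_
    rw [dist_comm, dist_zero_right]; linarith
  · refine le_trans (le_of_eq ?_) (le_self_add.trans hple)
    simp only [sc_gsq hv p one_pos]
    simp only [hT1, one_mul, one_smul, one_pow]
    have hS : ∀ p : Euc n, MeasurableSet {X : Euc n × ℝ | ‖X.1 - p‖ ≤ 2 * r} := fun p =>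
      measurableSet_le (by fun_prop) measurable_const
    have hS0 := hS 0
    simp only [sub_zero] at hS0
    rw [← lintegral_indicator hS0, ← lintegral_indicator (hS p), mu, lintegral_prod_symm, lintegral_prod_symm]
    · refine lintegral_congr fun y => ?_
      rw [← lintegral_add_right_eq_self (fun x => ({X : Euc n × ℝ | ‖X.1 - p‖ ≤ 2*r}).indicator (fun X => ENNReal.ofReal (gsq n v X)) (x, y)) p]
      refine lintegral_congr fun x => ?_
      simp only [indicator, mem_setOf_eq, add_sub_cancel_right]
    · exact (hgm.indicator (hS p)).aemeasurable
    · refine Measurable.aemeasurable (Measurable.indicator ?_ hS0)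
      fun_prop
  · refine le_trans (le_of_eq ?_) (le_add_self.trans hple)
    simp only [hT3, one_mul, one_smul]
    have hS : MeasurableSet {x : Euc n | ‖x - p‖ ≤ 2 * r} := measurableSet_le (by fun_prop) measurable_const
    rw [← lintegral_indicator measurableSet_closedBall, ← lintegral_indicator hS,
      ← lintegral_add_right_eq_self ({x : Euc n | ‖x - p‖ ≤ 2*r}.indicator fun x => ENNReal.ofReal (|v (x,0)|^q)) p]
    refine lintegral_congr fun x => ?_
    simp only [indicator, mem_setOf_eq, add_sub_cancel_right, mem_closedBall_iff_norm, sub_zero]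

open scoped ENNReal

lemma sq_bound {n : ℕ} {s : ℝ} (hs : s ∈ Ioo (0:ℝ) 1) {u : Euc n × ℝ → ℝ} (h : Tst n u) (x : Euc n)
    {y R : ℝ} (hy : 0 < y) (hyR : y ≤ R) :
    ENNReal.ofReal (u (x, y) ^ 2) ≤ ENNReal.ofReal (2 * u (x, 0) ^ 2) +
      ENNReal.ofReal (4 / s * R ^ (2*s)) * ∫⁻ t, ENNReal.ofReal (gsq n u (x, t)) ∂(wt s) := by
  have hs0 := hs.1
  have hR : 0 < R := hy.trans_le hyR
  set A := ∫⁻ t, ENNReal.ofReal (gsq n u (x, t)) ∂(wt s) with hA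
  by_cases hAt : A = ⊤
  · rw [hAt, ENNReal.mul_top]
    · simp
    · have : 0 < 4 / s * R ^ (2*s) := by positivity
      simpa using this
  set a := A.toReal with ha
  have haA : A = ENNReal.ofReal a := (ENNReal.ofReal_toReal hAt).symm
  have ha0 : 0 ≤ a := ENNReal.toReal_nonneg
  set b := y ^ (2*s) / (2*s) with hb
  have hb0 : 0 < b := by positivity
  have key : ∀ κ : ℝ, 0 < κ → |u (x, y) - u (x, 0)| ≤ κ * a + κ⁻¹ * b := by
    intro κ hκ
    have := up_bound hs h x 0 (by simp) hy hκ
    simp only [smul_zero, add_zero] at this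
    rw [← hA, haA, ← ENNReal.ofReal_mul hκ.le, ← ENNReal.ofReal_add (by positivity) (by positivity),
      ← ofReal_norm_eq_enorm, ENNReal.ofReal_le_ofReal_iff (by positivity)] at this
    exact this
  have hd : |u (x, y) - u (x, 0)| ^ 2 ≤ 4 * a * b := by
    rcases (abs_nonneg (u (x, y) - u (x, 0))).eq_or_lt with h0 | h0
    · rw [← h0]; simp; positivity
    · set d := |u (x, y) - u (x, 0)|
      have := key (2 * b / d) (by positivity)
      have e : (2 * b / d)⁻¹ * b = d / 2 := by field_simp
      rw [e] at this
      have h2 : d / 2 ≤ 2 * b / d * a := by linarith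
      have h3 : d / 2 * d ≤ 2 * b / d * a * d := mul_le_mul_of_nonneg_right h2 h0.le
      have e2 : 2 * b / d * a * d = 2 * b * a := by field_simp
      nlinarith
  rw [sq_abs] at hd
  rw [haA, ← ENNReal.ofReal_mul (by positivity), ← ENNReal.ofReal_add (by positivity) (by positivity)]
  refine ENNReal.ofReal_le_ofReal ?_
  have h1 : y ^ (2*s) ≤ R ^ (2*s) := Real.rpow_le_rpow hy.le hyR (by positivity)
  have h2 : 8 * a * b ≤ 4 / s * R ^ (2*s) * a := by
    rw [hb]
    have e : 8 * a * (y ^ (2*s) / (2*s)) = 4 / s * y ^ (2*s) * a := by field_simp; ring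
    rw [e]; gcongr
  nlinarith [sq_nonneg (u (x, y) - 2 * u (x, 0))]

lemma wt_Iic {s : ℝ} (hs : s ∈ Ioo (0:ℝ) 1) {R : ℝ} (hR : 0 < R) :
    wt s (Iic R) = ENNReal.ofReal (R ^ (2 - 2*s) / (2 - 2*s)) := by
  rw [wt, withDensity_apply _ measurableSet_Iic, Measure.restrict_restrict measurableSet_Iic, inter_comm, Ioi_inter_Iic]
  have := lpow (A := 1) zero_le_one (b := 2 - 2*s) (by linarith [hs.2]) hR
  rw [one_mul] at this
  rw [← this]
  refine setLIntegral_congr_fun measurableSet_Ioc fun t ht => ?_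
  simp only [one_mul]
  congr 2; ring

lemma vol_cb {n : ℕ} {R : ℝ} (hR : 0 < R) : volume (Metric.closedBall (0 : Euc n) R) =
    ENNReal.ofReal (R ^ n * (volume (Metric.ball (0 : Euc n) 1)).toReal) := by
  rw [Measure.addHaar_closedBall _ _ (by positivity), finrank_euclideanSpace, Fintype.card_fin,
    ENNReal.ofReal_mul (by positivity), ENNReal.ofReal_toReal measure_ball_lt_top.ne]

lemma sq_le_one_add {t q : ℝ} (ht : 0 ≤ t) (hq : 2 ≤ q) : t ^ 2 ≤ 1 + t ^ q := by
  rcases le_total t 1 with h | h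
  · have := Real.rpow_nonneg ht q
    nlinarith
  · have := Real.rpow_le_rpow_of_exponent_le h hq
    rw [Real.rpow_two] at this
    linarith

lemma q_two {n : ℕ} {s : ℝ} (hs : s ∈ Ioo (0:ℝ) 1) (hns : 2 * s < (n:ℝ)) : 2 ≤ 2*(n:ℝ) / ((n:ℝ) - 2*s) := by
  rw [le_div_iff₀ (by linarith)]
  nlinarith [hs.1]

lemma bulk {n : ℕ} {s : ℝ} (hs : s ∈ Ioo (0:ℝ) 1) (hns : 2 * s < (n:ℝ)) {C : ℝ} (hC : 0 < C) :
    ∃ D > 0, ∀ r > 0, r ≤ 1 → ∀ v, Tst n v →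
       ∫⁻ X in {X | ‖X.1‖ ≤ 2 * r}, ENNReal.ofReal (gsq n v X) ∂(mu n s) ≤ ENNReal.ofReal (C * r ^ n) →
       ∫⁻ x in Metric.closedBall (0 : Euc n) (2 * r), ENNReal.ofReal (|v (x, 0)| ^ (2*(n:ℝ) / ((n:ℝ) - 2*s))) ≤ ENNReal.ofReal (C * r ^ n) →
       ∫⁻ X in Metric.closedBall (0 : Euc n) (2 * r) ×ˢ Iic (2 * r), ENNReal.ofReal (v X ^ 2) ∂(mu n s) ≤ ENNReal.ofReal (D * (r ^ n * r ^ (2 - 2*s))) := by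
  have hs0 := hs.1
  have hs1 := hs.2
  set w := (volume (Metric.ball (0 : Euc n) 1)).toReal with hw
  have hw0 : 0 ≤ w := ENNReal.toReal_nonneg
  have h22 : 0 < 2 - 2 * s := by linarith
  refine ⟨(2 * (2 ^ n * w + C) + 4 / s * 4 * C) * (2 ^ (2 - 2*s) / (2 - 2*s)), by positivity, ?_⟩
  intro r hr hr1 v hv h1 h3
  set q := 2*(n:ℝ) / ((n:ℝ) - 2*s)
  have hq2 : 2 ≤ q := q_two hs hns
  have hR : 0 < 2 * r := by positivity
  have hvc := hv.1.continuous
  have hgc := hv.cont_gsq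
  have hgm : Measurable (fun X : Euc n × ℝ => ENNReal.ofReal (gsq n v X)) := hgc.measurable.ennreal_ofReal
  have hAm : Measurable (fun x : Euc n => ∫⁻ t, ENNReal.ofReal (gsq n v (x, t)) ∂(wt s)) :=
    hgm.lintegral_prod_right'
  rw [mu, ← Measure.prod_restrict, lintegral_prod _ (by fun_prop)]
  have hset : {X : Euc n × ℝ | ‖X.1‖ ≤ 2 * r} = Metric.closedBall (0 : Euc n) (2 * r) ×ˢ univ := by
    ext X; simp
  rw [hset, mu, ← Measure.prod_restrict, lintegral_prod _ (by fun_prop), Measure.restrict_univ] at h1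
  have hinner : ∀ x : Euc n, ∫⁻ y in Iic (2*r), ENNReal.ofReal (v (x, y) ^ 2) ∂(wt s) ≤
      (ENNReal.ofReal (2 * v (x, 0) ^ 2) + ENNReal.ofReal (4 / s * (2*r) ^ (2*s)) * ∫⁻ t, ENNReal.ofReal (gsq n v (x, t)) ∂(wt s))
       * wt s (Iic (2*r)) := by
    intro x
    rw [← setLIntegral_const]
    refine lintegral_mono_ae ?_
    filter_upwards [ae_restrict_mem measurableSet_Iic, ae_restrict_of_ae (ae_wt_pos s)] with y hy hy0
    exact sq_bound hs hv x hy0 hy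
  refine (lintegral_mono hinner).trans ?_
  rw [lintegral_mul_const' _ _ (wt_Iic_lt_top hs _).ne, lintegral_add_left (by fun_prop), lintegral_const_mul' _ _ ENNReal.ofReal_ne_top]
  have hp : (2*r) ^ (2*s) ≤ 4 := by
    calc (2*r) ^ (2*s) ≤ 2 ^ (2*s) := Real.rpow_le_rpow hR.le (by linarith) (by positivity)
      _ ≤ 2 ^ (2:ℝ) := Real.rpow_le_rpow_of_exponent_le (by norm_num) (by linarith)
      _ = 4 := by norm_num
  have hfirst : ∫⁻ x in Metric.closedBall (0 : Euc n) (2 * r), ENNReal.ofReal (2 * v (x, 0) ^ 2) ≤ ENNReal.ofReal (2 * (2 ^ n * w + C) * r ^ n) := by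
    calc ∫⁻ x in Metric.closedBall (0 : Euc n) (2 * r), ENNReal.ofReal (2 * v (x, 0) ^ 2)
        ≤ ∫⁻ x in Metric.closedBall (0 : Euc n) (2 * r), ENNReal.ofReal 2 * (1 + ENNReal.ofReal (|v (x, 0)| ^ q)) := by
          refine lintegral_mono fun x => ?_
          simp only
          rw [← ENNReal.ofReal_one, ← ENNReal.ofReal_add zero_le_one (by positivity), ← ENNReal.ofReal_mul zero_le_two]
          refine ENNReal.ofReal_le_ofReal ?_
          have := sq_le_one_add (abs_nonneg (v (x, 0))) hq2
          rw [sq_abs] at this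
          linarith
      _ = ENNReal.ofReal 2 * (volume (Metric.closedBall (0 : Euc n) (2 * r)) + ∫⁻ x in Metric.closedBall (0 : Euc n) (2 * r), ENNReal.ofReal (|v (x, 0)| ^ q)) := by
          rw [lintegral_const_mul' _ _ ENNReal.ofReal_ne_top, lintegral_add_left measurable_const, setLIntegral_const, one_mul]
      _ ≤ ENNReal.ofReal 2 * (ENNReal.ofReal ((2*r)^n * w) + ENNReal.ofReal (C * r ^ n)) := by
          rw [vol_cb hR]
          gcongr
      _ = _ := by
          rw [← ENNReal.ofReal_add (by positivity) (by positivity), ← ENNReal.ofReal_mul zero_le_two]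
          congr 1; rw [mul_pow]; ring
  calc _ ≤ (ENNReal.ofReal (2 * (2 ^ n * w + C) * r ^ n) + ENNReal.ofReal (4 / s * 4) * ENNReal.ofReal (C * r ^ n)) * ENNReal.ofReal ((2*r) ^ (2 - 2*s) / (2 - 2*s)) := by
        rw [wt_Iic hs hR]
        gcongr
    _ = _ := by
        rw [← ENNReal.ofReal_mul (by positivity), ← ENNReal.ofReal_add (by positivity) (by positivity), ← ENNReal.ofReal_mul (by positivity)]
        congr 1
        rw [Real.mul_rpow zero_le_two hr.le]; ring

open scoped ENNReal

lemma gsq_mul_le {n : ℕ} {p v : Euc n × ℝ → ℝ} {X : Euc n × ℝ} (hp : DifferentiableAt ℝ p X) (hv : DifferentiableAt ℝ v X) :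
    gsq n (fun Y => p Y * v Y) X ≤ 2 * p X ^ 2 * gsq n v X + 2 * v X ^ 2 * gsq n p X := by
  have e : ∀ V, fderiv ℝ (fun Y => p Y * v Y) X V = p X * fderiv ℝ v X V + v X * fderiv ℝ p X V := by
    intro V
    rw [fderiv_fun_mul hp hv]; simp
  have k : ∀ a b c d : ℝ, (a * b + c * d) ^ 2 ≤ 2 * a ^ 2 * b ^ 2 + 2 * c ^ 2 * d ^ 2 := by
    intro a b c d; nlinarith [sq_nonneg (a * b - c * d)]
  unfold gsq
  simp only [e]
  rw [mul_add, mul_add, Finset.mul_sum, Finset.mul_sum]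
  have := Finset.sum_le_sum (s := Finset.univ) fun (i : Fin n) _ => k (p X) (fderiv ℝ v X (EuclideanSpace.single i 1, 0)) (v X) (fderiv ℝ p X (EuclideanSpace.single i 1, 0))
  rw [Finset.sum_add_distrib] at this
  have h2 := k (p X) (fderiv ℝ v X (0,1)) (v X) (fderiv ℝ p X (0,1))
  linarith

lemma cutoff {n : ℕ} {s : ℝ} (hs : s ∈ Ioo (0:ℝ) 1) (hns : 2 * s < (n:ℝ)) {C : ℝ} (hC : 0 < C) :
    ∃ D > 0, ∀ r > 0, r ≤ 1 → ∀ v, Tst n v →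
       ∫⁻ X in {X | ‖X.1‖ ≤ 2 * r}, ENNReal.ofReal (gsq n v X) ∂(mu n s) ≤ ENNReal.ofReal (C * r ^ n) →
       ∫⁻ x in Metric.closedBall (0 : Euc n) (2 * r), ENNReal.ofReal (|v (x, 0)| ^ (2*(n:ℝ) / ((n:ℝ) - 2*s))) ≤ ENNReal.ofReal (C * r ^ n) →
       ∃ h, Tst n h ∧ (∀ X, nq X < r ^ 2 → h X = 0) ∧ En n s h ≤ En n s v + D * r ^ ((n:ℝ) - 2*s) ∧
         (∀ X, |h X| ≤ |v X|) ∧ ∀ x : Euc n, 2 * r < ‖x‖ → h (x, 0) = v (x, 0) := by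
  obtain ⟨D, hD, hbulk⟩ := bulk hs hns hC
  let φ : ContDiffBump (0 : Euc n × ℝ) := ⟨1, 2, one_pos, by norm_num⟩
  have hφ : Tst n φ := ⟨φ.contDiff, φ.hasCompactSupport⟩
  obtain ⟨M, hM⟩ := hφ.supp_gsq.exists_bound_of_continuous hφ.cont_gsq
  have hM' : ∀ X, gsq n φ X ≤ M := fun X => (le_abs_self _).trans (hM X)
  have hM0 : 0 ≤ M := (gsq_nonneg _ 0).trans (hM' 0)
  refine ⟨C + 2 * M * D, by positivity, ?_⟩
  intro r hr hr1 v hv h1 h3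
  have hb := hbulk r hr hr1 v hv h1 h3
  have hr' : 0 < r⁻¹ := by positivity
  set p : Euc n × ℝ → ℝ := fun X => 1 * φ (r⁻¹ • X.1 + 0, r⁻¹ * X.2) with hp
  have hpT : Tst n p := hφ.sc 0 hr' 1
  have hpe : ∀ X, p X = φ (r⁻¹ • X) := by intro X; simp only [hp, one_mul, add_zero]; rfl
  have hp01 : ∀ X, 0 ≤ p X ∧ p X ≤ 1 := by intro X; rw [hpe]; exact ⟨φ.nonneg, φ.le_one⟩
  have hpg : ∀ X, gsq n p X ≤ (r⁻¹) ^ 2 * M := by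
    intro X
    rw [hp, sc_gsq hφ 0 hr', one_pow, one_mul]
    exact mul_le_mul_of_nonneg_left (hM' _) (by positivity)
  set ψ : Euc n × ℝ → ℝ := fun X => 1 - p X with hψ
  have hψcd : ContDiff ℝ (⊤ : ℕ∞) ψ := contDiff_const.sub hpT.1
  have hψd : Differentiable ℝ ψ := hψcd.differentiable (by simp)
  have hψg : ∀ X, gsq n ψ X = gsq n p X := by
    intro X
    unfold gsq
    have : fderiv ℝ ψ X = - fderiv ℝ p X := by rw [hψ, fderiv_const_sub]
    simp [this]
  have hψ01 : ∀ X, 0 ≤ ψ X ∧ ψ X ≤ 1 := by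
    intro X; have := hp01 X; simp only [hψ]; constructor <;> linarith
  have hoff : ∀ X : Euc n × ℝ, 2 * r ≤ ‖X‖ → ψ X = 1 := by
    intro X hX
    simp only [hψ, hpe]
    rw [φ.zero_of_le_dist]
    · simp
    · show 2 ≤ _
      rw [dist_zero_right, norm_smul, Real.norm_of_nonneg hr'.le, inv_mul_eq_div, le_div_iff₀ hr]
      exact hX
  set S := Metric.closedBall (0 : Euc n) (2 * r) ×ˢ Iic (2 * r) with hS
  have hSm : MeasurableSet S := measurableSet_closedBall.prod measurableSet_Iic
  have hSc : IsClosed S := Metric.isClosed_closedBall.prod isClosed_Iic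
  have hSn : ∀ X ∉ S, 2 * r ≤ ‖X‖ := by
    intro X hX
    by_contra hlt
    push Not at hlt
    apply hX
    refine ⟨?_, ?_⟩
    · rw [mem_closedBall_zero_iff]; exact (norm_fst_le X).trans hlt.le
    · exact ((le_abs_self _).trans (norm_snd_le X)).trans hlt.le
  set h : Euc n × ℝ → ℝ := fun X => ψ X * v X with hh
  have hhT : Tst n h := ⟨hψcd.mul hv.1, hv.2.mul_left⟩
  have hgm : Measurable (fun X : Euc n × ℝ => ENNReal.ofReal (gsq n v X)) := hv.cont_gsq.measurable.ennreal_ofReal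
  have hvm : Measurable (fun X : Euc n × ℝ => ENNReal.ofReal (v X ^ 2)) := (hv.1.continuous.pow 2).measurable.ennreal_ofReal
  have hpt : ∀ X, ENNReal.ofReal (gsq n h X) ≤ ENNReal.ofReal (gsq n v X) +
      S.indicator (fun X => ENNReal.ofReal (gsq n v X) + ENNReal.ofReal (2 * M * (r⁻¹) ^ 2) * ENNReal.ofReal (v X ^ 2)) X := by
    intro X
    by_cases hX : X ∈ S
    · rw [indicator_of_mem hX, ← ENNReal.ofReal_mul (by positivity), ← ENNReal.ofReal_add (gsq_nonneg _ _) (by positivity),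
        ← ENNReal.ofReal_add (gsq_nonneg _ _) (add_nonneg (gsq_nonneg _ _) (by positivity))]
      refine ENNReal.ofReal_le_ofReal ((gsq_mul_le (hψd X) (hv.diff X)).trans ?_)
      rw [hψg]
      have a1 := hψ01 X
      have a2 : ψ X ^ 2 ≤ 1 := by nlinarith
      have a3 := mul_le_mul_of_nonneg_right a2 (gsq_nonneg v X)
      have a4 := mul_le_mul_of_nonneg_left (hpg X) (sq_nonneg (v X))
      nlinarith
    · rw [indicator_of_notMem hX, add_zero]
      refine le_of_eq ?_
      have : h =ᶠ[𝓝 X] v := by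
        filter_upwards [hSc.isOpen_compl.mem_nhds hX] with Y hY
        simp only [hh, hoff Y (hSn Y hY), one_mul]
      unfold gsq
      rw [this.fderiv_eq]
  refine ⟨h, hhT, ?_, ?_, ?_, ?_⟩
  · intro X hX
    have h1 : ‖X‖ ≤ r := norm_le_nq hr.le hX.le
    have : p X = 1 := by
      rw [hpe]
      refine φ.one_of_mem_closedBall ?_
      show _ ≤ (1:ℝ)
      rw [dist_zero_right, norm_smul, Real.norm_of_nonneg hr'.le, inv_mul_eq_div, div_le_one hr]
      exact h1
    simp [hh, hψ, this]
  · have hEv := En_nonneg (s := s) v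
    have hrn : (0:ℝ) < r ^ ((n:ℝ) - 2*s) := by positivity
    have e1 : ENNReal.ofReal (En n s h) = ∫⁻ X, ENNReal.ofReal (gsq n h X) ∂(mu n s) := by
      rw [En, ofReal_integral_eq_lintegral_ofReal (hhT.int_gsq hs) (Eventually.of_forall (gsq_nonneg h))]
    have e2 : ENNReal.ofReal (En n s v) = ∫⁻ X, ENNReal.ofReal (gsq n v X) ∂(mu n s) := by
      rw [En, ofReal_integral_eq_lintegral_ofReal (hv.int_gsq hs) (Eventually.of_forall (gsq_nonneg v))]
    rw [← ENNReal.ofReal_le_ofReal_iff (by positivity), e1]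
    refine (lintegral_mono hpt).trans ?_
    rw [lintegral_add_left hgm, ← e2, lintegral_indicator hSm, lintegral_add_left hgm, lintegral_const_mul' _ _ ENNReal.ofReal_ne_top]
    have h1' : ∫⁻ X in S, ENNReal.ofReal (gsq n v X) ∂(mu n s) ≤ ENNReal.ofReal (C * r ^ n) := by
      refine (lintegral_mono_set ?_).trans h1
      intro X hX
      simpa using hX.1
    calc _ ≤ ENNReal.ofReal (En n s v) + (ENNReal.ofReal (C * r ^ n) + ENNReal.ofReal (2 * M * (r⁻¹) ^ 2) * ENNReal.ofReal (D * (r ^ n * r ^ (2 - 2*s)))) := by gcongr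
      _ ≤ _ := by
        rw [← ENNReal.ofReal_mul (by positivity), ← ENNReal.ofReal_add (by positivity) (by positivity), ← ENNReal.ofReal_add (by positivity) (by positivity)]
        refine ENNReal.ofReal_le_ofReal ?_
        have f1 : r ^ n ≤ r ^ ((n:ℝ) - 2*s) := by
          rw [← Real.rpow_natCast]
          exact Real.rpow_le_rpow_of_exponent_ge hr hr1 (by linarith [hs.1])
        have f2 : (r⁻¹) ^ 2 * (r ^ n * r ^ (2 - 2*s)) = r ^ ((n:ℝ) - 2*s) := by
          rw [← Real.rpow_natCast r n, ← Real.rpow_add hr, inv_pow, ← Real.rpow_natCast r 2, ← Real.rpow_neg hr.le, ← Real.rpow_add hr]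
          congr 1; push_cast; ring
        have f3 : 2 * M * r⁻¹ ^ 2 * (D * (r ^ n * r ^ (2 - 2 * s))) = 2 * M * D * r ^ ((n:ℝ) - 2*s) := by
          rw [← f2]; ring
        rw [f3]
        have := mul_le_mul_of_nonneg_left f1 hC.le
        linarith
  · intro X
    simp only [hh, abs_mul]
    have := hψ01 X
    rw [abs_of_nonneg this.1]
    exact mul_le_of_le_one_left (abs_nonneg _) this.2
  · intro x hx
    have : ψ (x, 0) = 1 := hoff _ (hx.le.trans (norm_fst_le (x, (0:ℝ))))
    simp [hh, this]

open scoped ENNReal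

lemma trace_bounds {n : ℕ} (hn : 1 ≤ n) {s : ℝ} (hs : s ∈ Ioo (0:ℝ) 1) (hns : 2 * s < (n:ℝ)) {a C r : ℝ} (hC : 0 < C) (hr : 0 < r)
    {v h : Euc n × ℝ → ℝ} (hv : Tst n v) (hh : Tst n h)
    (h3 : ∫⁻ x in Metric.closedBall (0 : Euc n) (2 * r), ENNReal.ofReal (|v (x, 0)| ^ (2*(n:ℝ) / ((n:ℝ) - 2*s))) ≤ ENNReal.ofReal (C * r ^ n))
    (hle : ∀ X, |h X| ≤ |v X|) (heq : ∀ x : Euc n, 2 * r < ‖x‖ → h (x, 0) = v (x, 0))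
    (ha : a ≤ ∫ x in Metric.ball (0 : Euc n) 2, |v (x, 0)|) :
    NN n s h ≤ NN n s v ∧ NN n s v - C * r ^ n ≤ NN n s h ∧
     a - (2 ^ n * (volume (Metric.ball (0 : Euc n) 1)).toReal + C) * r ^ n ≤ ∫ x in Metric.ball (0 : Euc n) 2, |h (x, 0)| := by
  have hq := q_pos hn hns
  have hq2 := q_two hs hns
  unfold NN
  set q := 2*(n:ℝ) / ((n:ℝ) - 2*s)
  set S := Metric.closedBall (0 : Euc n) (2 * r) with hS
  have hSm : MeasurableSet S := measurableSet_closedBall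
  have iv := hv.tr_pow_int hq
  have ih := hh.tr_pow_int hq
  have hcb : ∫ x in S, |v (x, 0)| ^ q ≤ C * r ^ n := by
    rwa [← ofReal_integral_eq_lintegral_ofReal iv.integrableOn (Eventually.of_forall fun x => by positivity),
      ENNReal.ofReal_le_ofReal_iff (by positivity)] at h3
  have hnot : ∀ x ∉ S, h (x, 0) = v (x, 0) := by
    intro x hx
    apply heq
    rw [hS, mem_closedBall_zero_iff] at hx
    linarith
  refine ⟨?_, ?_, ?_⟩
  · exact integral_mono ih iv fun x => Real.rpow_le_rpow (abs_nonneg _) (hle _) hq.le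
  · have : ∫ x, |v (x, 0)| ^ q ≤ ∫ x, (|h (x, 0)| ^ q + S.indicator (fun x => |v (x, 0)| ^ q) x) := by
      refine integral_mono iv (ih.add (iv.indicator hSm)) fun x => ?_
      by_cases hx : x ∈ S
      · simp only [indicator_of_mem hx]
        have : 0 ≤ |h (x, 0)| ^ q := by positivity
        linarith
      · simp only [indicator_of_notMem hx, hnot x hx, add_zero, le_refl]
    rw [integral_add ih (iv.indicator hSm), integral_indicator hSm] at this
    linarith
  · have hball : ∀ {u : Euc n × ℝ → ℝ}, Tst n u → Integrable (fun x : Euc n => |u (x, 0)|) (volume.restrict (Metric.ball (0 : Euc n) 2)) := by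
      intro u hu
      exact ((hu.tr_cont.integrable_of_hasCompactSupport hu.tr_supp).abs).integrableOn
    have i1 : IntegrableOn (fun x : Euc n => 1 + |v (x, 0)| ^ q) S := by
      refine Integrable.add ?_ iv.integrableOn
      exact integrableOn_const (hs := measure_closedBall_lt_top.ne)
    have i2 : Integrable (S.indicator fun x : Euc n => 1 + |v (x, 0)| ^ q) := i1.integrable_indicator hSm
    have : ∫ x in Metric.ball (0 : Euc n) 2, |v (x, 0)| ≤ ∫ x in Metric.ball (0 : Euc n) 2, (|h (x, 0)| + S.indicator (fun x => 1 + |v (x, 0)| ^ q) x) := by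
      refine integral_mono (hball hv) ((hball hh).add i2.integrableOn) fun x => ?_
      by_cases hx : x ∈ S
      · simp only [indicator_of_mem hx]
        have h1 := sq_le_one_add (abs_nonneg (v (x, 0))) hq2
        have h2 : |v (x, 0)| ≤ 1 + |v (x, 0)| ^ q := by
          rcases le_total |v (x, 0)| 1 with h | h
          · have : 0 ≤ |v (x, 0)| ^ q := by positivity
            linarith
          · nlinarith
        have := abs_nonneg (h (x, 0))
        linarith
      · simp only [indicator_of_notMem hx, hnot x hx, add_zero, le_refl]
    rw [integral_add (hball hh) i2.integrableOn] at this
    have h5 : ∫ x in Metric.ball (0 : Euc n) 2, S.indicator (fun x => 1 + |v (x, 0)| ^ q) x ≤ ∫ x, S.indicator (fun x => 1 + |v (x, 0)| ^ q) x := by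
      refine setIntegral_le_integral i2 (Eventually.of_forall fun x => ?_)
      exact indicator_nonneg (fun x _ => by positivity) x
    have h6 : ∫ x, S.indicator (fun x => 1 + |v (x, 0)| ^ q) x = (2*r)^n * (volume (Metric.ball (0 : Euc n) 1)).toReal + ∫ x in S, |v (x, 0)| ^ q := by
      have ic : Integrable (fun _ : Euc n => (1:ℝ)) (volume.restrict S) := integrableOn_const (hs := measure_closedBall_lt_top.ne)
      rw [integral_indicator hSm, integral_add ic iv.integrableOn, setIntegral_const,
        smul_eq_mul, mul_one, Measure.real, hS, vol_cb (by positivity), ENNReal.toReal_ofReal (by positivity)]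
    rw [mul_pow] at h6
    linarith

lemma l1_l2 {n : ℕ} {h : Euc n × ℝ → ℝ} (hh : Tst n h) {b : ℝ} (hb : 0 < b)
    (hle : b ≤ ∫ x in Metric.ball (0 : Euc n) 2, |h (x, 0)|) :
    b ^ 2 / (volume (Metric.ball (0 : Euc n) 2)).toReal ≤ ∫ x in Metric.ball (0 : Euc n) 2, h (x, 0) ^ 2 := by
  set V := (volume (Metric.ball (0 : Euc n) 2)).toReal with hV
  have hV0 : 0 < V := ENNReal.toReal_pos (Metric.measure_ball_pos _ _ two_pos).ne' measure_ball_lt_top.ne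
  set κ := b / V
  have hκ : 0 < κ := by positivity
  have i1 : IntegrableOn (fun x : Euc n => |h (x, 0)|) (Metric.ball (0 : Euc n) 2) :=
    ((hh.tr_cont.integrable_of_hasCompactSupport hh.tr_supp).abs).integrableOn
  have i2 : IntegrableOn (fun x : Euc n => h (x, 0) ^ 2) (Metric.ball (0 : Euc n) 2) := by
    refine ((hh.tr_cont.pow 2).integrable_of_hasCompactSupport (hh.tr_supp.mono ?_)).integrableOn
    intro x hx hx0
    exact hx (by simp only at hx0; simp [hx0])
  have ic : IntegrableOn (fun _ : Euc n => κ ^ 2) (Metric.ball (0 : Euc n) 2) := integrableOn_const (hs := measure_ball_lt_top.ne)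
  have : ∫ x in Metric.ball (0 : Euc n) 2, (2 * κ * |h (x, 0)| - κ ^ 2) ≤ ∫ x in Metric.ball (0 : Euc n) 2, h (x, 0) ^ 2 := by
    refine integral_mono ((i1.const_mul _).sub ic) i2 fun x => ?_
    simp only
    nlinarith [sq_nonneg (|h (x, 0)| - κ), sq_abs (h (x, 0))]
  rw [integral_sub (i1.const_mul _) ic, integral_const_mul, setIntegral_const, smul_eq_mul, Measure.real, ← hV] at this
  refine le_trans ?_ this
  have e : b ^ 2 / V = 2 * κ * b - V * κ ^ 2 := by simp only [κ]; field_simp; ring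
  rw [e]
  have := mul_le_mul_of_nonneg_left hle (by positivity : 0 ≤ 2 * κ)
  linarith

lemma kel_l2 {n : ℕ} (hn : 1 ≤ n) {s : ℝ} (hs : s ∈ Ioo (0:ℝ) 1) {r : ℝ} (hr : 0 < r)
    {h : Euc n × ℝ → ℝ} (hh : Tst n h) (h0 : ∀ X, nq X < r ^ 2 → h X = 0) :
    4 ^ (-(2*s)) * ∫ x in Metric.ball (0 : Euc n) 2, h (x, 0) ^ 2 ≤ ∫ x : Euc n, (kel ((n:ℝ) - 2*s) h (x, 0)) ^ 2 := by
  have hs0 := hs.1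
  have h00 : h 0 = 0 := h0 0 (by rw [nq_eq]; simp; positivity)
  rw [kel_tr2 hn rfl h00]
  have i2 : Integrable (fun x : Euc n => h (x, 0) ^ 2) := by
    refine ((hh.tr_cont.pow 2).integrable_of_hasCompactSupport (hh.tr_supp.mono ?_))
    intro x hx hx0
    exact hx (by simp only at hx0; simp [hx0])
  have hn0 : ∀ x : Euc n, nq ((x, 0) : Euc n × ℝ) = ‖x‖ ^ 2 := by intro x; simp [nq_eq]
  have iF : Integrable (fun x : Euc n => (‖x‖ ^ 2) ^ (-(2 * s)) * (h (x, 0)) ^ 2) := by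
    have hm : Measurable (fun x : Euc n => (‖x‖ ^ 2) ^ (-(2 * s)) * (h (x, 0)) ^ 2) := by
      have h1 := hh.tr_cont.measurable
      exact Measurable.mul (by fun_prop) (h1.pow_const 2)
    refine (i2.const_mul ((r ^ 2) ^ (-(2*s)))).mono' hm.aestronglyMeasurable (Eventually.of_forall fun x => ?_)
    rw [Real.norm_of_nonneg (by positivity)]
    by_cases hx : nq ((x, 0) : Euc n × ℝ) < r ^ 2
    · simp [h0 _ hx]
    · rw [hn0] at hx
      push Not at hx
      refine mul_le_mul_of_nonneg_right ?_ (sq_nonneg _)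
      exact Real.rpow_le_rpow_of_nonpos (by positivity) hx (by linarith)
  refine le_trans ?_ (setIntegral_le_integral (s := Metric.ball (0 : Euc n) 2) iF (Eventually.of_forall fun x => by positivity))
  rw [← integral_const_mul]
  refine setIntegral_mono_on (i2.const_mul _).integrableOn iF.integrableOn measurableSet_ball fun x hx => ?_
  rw [mem_ball_zero_iff] at hx
  by_cases hx0 : x = 0
  · subst hx0
    have : h ((0 : Euc n), (0:ℝ)) = 0 := h00
    simp [this]
  · refine mul_le_mul_of_nonneg_right ?_ (sq_nonneg _)
    have : 0 < ‖x‖ := norm_pos_iff.2 hx0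
    refine Real.rpow_le_rpow_of_nonpos (by positivity) ?_ (by linarith)
    nlinarith

lemma propP {n : ℕ} (hn : 1 ≤ n) {s : ℝ} (hs : s ∈ Ioo (0:ℝ) 1) (hns : 2 * s < (n:ℝ)) :
    ∃ C > 0, ∃ c > 0, ∃ r1 > 0, ∀ r > 0, r ≤ r1 → ∃ g, Tst n g ∧ (∀ X, g X ≠ 0 → nq X ≤ (r⁻¹) ^ 2) ∧ 0 < NN n s g ∧
      En n s g ≤ (sInf (KQuotSet n s) + C * r ^ ((n:ℝ) - 2*s)) * NN n s g ^ (((n:ℝ) - 2*s) / (n:ℝ)) ∧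
      c * NN n s g ^ (((n:ℝ) - 2*s) / (n:ℝ)) ≤ ∫ x : Euc n, g (x, 0) ^ 2 := by
  set K := sInf (KQuotSet n s)
  have hK : 0 ≤ K := K_nonneg n s
  have hs0 := hs.1
  have hm : 0 < (n:ℝ) - 2*s := by linarith
  have hn0 : (0:ℝ) < n := by linarith
  obtain ⟨a, ha, C, hC, H⟩ := step3a hn hs hns (B := K + 1) (by positivity)
  obtain ⟨D, hD, Hc⟩ := cutoff hs hns hC
  set w := (volume (Metric.ball (0 : Euc n) 1)).toReal with hw
  have hw0 : 0 ≤ w := ENNReal.toReal_nonneg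
  have hV0 : 0 < (volume (Metric.ball (0 : Euc n) 2)).toReal := ENNReal.toReal_pos (Metric.measure_ball_pos _ _ two_pos).ne' measure_ball_lt_top.ne
  refine ⟨2 * (K * C + 1 + D), by positivity, 4 ^ (-(2*s)) * ((a/2) ^ 2 / (volume (Metric.ball (0 : Euc n) 2)).toReal), by positivity,
    min 1 (min (1 / (2 * C)) (a / (2 * (2 ^ n * w + C)))), by positivity, ?_⟩
  intro r hr hrle
  have hr1 : r ≤ 1 := hrle.trans (min_le_left _ _)
  have hrC : r ≤ 1 / (2 * C) := hrle.trans ((min_le_right _ _).trans (min_le_left _ _))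
  have hra : r ≤ a / (2 * (2 ^ n * w + C)) := hrle.trans ((min_le_right _ _).trans (min_le_right _ _))
  have hrn : r ^ n ≤ r := pow_le_of_le_one hr.le hr1 (by omega)
  have hrn0 : 0 < r ^ n := by positivity
  have hrC' : C * r ^ n ≤ 1 / 2 := by
    rw [le_div_iff₀ (by positivity)] at hrC
    nlinarith
  have hra' : (2 ^ n * w + C) * r ^ n ≤ a / 2 := by
    rw [le_div_iff₀ (by positivity)] at hra
    have : (2 ^ n * w + C) * r ^ n ≤ (2 ^ n * w + C) * r := mul_le_mul_of_nonneg_left hrn (by positivity)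
    linarith
  have hrm : 0 < r ^ ((n:ℝ) - 2*s) := by positivity
  have hrm1 : r ^ ((n:ℝ) - 2*s) ≤ 1 := Real.rpow_le_one hr.le hr1 hm.le
  obtain ⟨u, hu, huN, huE⟩ := step0 hn hs hns hrm
  obtain ⟨v, hv, hvN, hvE, hva, hT1, hT3⟩ := H r hr u hu huN (by linarith)
  obtain ⟨h, hh, h0, hhE, hle, heq⟩ := Hc r hr hr1 v hv hT1 hT3
  obtain ⟨t1, t2, t3⟩ := trace_bounds hn hs hns hC hr hv hh hT3 hle heq hva
  have l2 := l1_l2 hh (b := a / 2) (by positivity) (by linarith)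
  have k2 := kel_l2 hn hs hr hh h0
  have h00 : h 0 = 0 := h0 0 (by rw [nq_eq]; simp; positivity)
  have hN : NN n s (kel ((n:ℝ) - 2*s) h) = NN n s h := kel_tr hn (by field_simp) h00 (q_pos hn hns).ne'
  refine ⟨kel ((n:ℝ) - 2*s) h, kel_tst _ hh hr h0, fun X hX => kel_supp _ hr h0 hX, ?_, ?_, ?_⟩
  · rw [hN]; linarith
  · rw [hN, kel_En hs hh hr h0]
    set N := NN n s h
    have hN0 : 0 < N := by linarith
    have hNN : N ≤ N ^ (((n:ℝ) - 2*s) / (n:ℝ)) := by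
      conv_lhs => rw [← Real.rpow_one N]
      refine Real.rpow_le_rpow_of_exponent_ge hN0 (by linarith) ?_
      rw [div_le_one hn0]; linarith
    refine hhE.trans ?_
    have f1 : r ^ n ≤ r ^ ((n:ℝ) - 2*s) := by
      rw [← Real.rpow_natCast]
      exact Real.rpow_le_rpow_of_exponent_ge hr hr1 (by linarith [hs.1])
    set ρ := r ^ ((n:ℝ) - 2*s)
    refine le_trans ?_ (mul_le_mul_of_nonneg_left hNN (by positivity))
    have g1 : 1 - C * ρ ≤ N := by nlinarith
    have g2 : 1 / 2 ≤ N := by linarith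
    have g3 := mul_le_mul_of_nonneg_left g1 hK
    have g4 := mul_le_mul_of_nonneg_left g2 (by positivity : 0 ≤ 2 * (K * C + 1 + D) * ρ)
    nlinarith
  · rw [hN]
    refine le_trans ?_ k2
    have : NN n s h ^ (((n:ℝ) - 2*s) / (n:ℝ)) ≤ 1 := Real.rpow_le_one (NN_nonneg h) (by linarith) (by positivity)
    calc _ ≤ 4 ^ (-(2*s)) * ((a/2) ^ 2 / (volume (Metric.ball (0 : Euc n) 2)).toReal) * 1 := by gcongr
      _ ≤ _ := by rw [mul_one]; gcongr

open scoped MatrixOrder in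
open scoped Matrix.Norms.L2Operator in
lemma fac {n : ℕ} {A : Matrix (Fin n) (Fin n) ℝ} (hA : A.PosDef) : ∃ B : Matrix (Fin n) (Fin n) ℝ, A = B.transpose * B ∧ IsUnit B.det := by
  obtain ⟨B, hB⟩ := CStarAlgebra.nonneg_iff_eq_star_mul_self.1 hA.posSemidef.nonneg
  have h2 : A = B.transpose * B := by rw [hB, Matrix.star_eq_conjTranspose, Matrix.conjTranspose_eq_transpose_of_trivial]
  refine ⟨B, h2, ?_⟩
  have := hA.det_pos
  rw [h2, Matrix.det_mul] at this
  exact isUnit_iff_ne_zero.2 fun h => by simp [h] at this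

lemma mkL {n : ℕ} (P Q : Matrix (Fin n) (Fin n) ℝ) (h1 : P * Q = 1) (h2 : Q * P = 1) :
    ∃ L : Euc n ≃L[ℝ] Euc n, (∀ x i, L x i = P.mulVec x.ofLp i) ∧ (∀ x i, L.symm x i = Q.mulVec x.ofLp i) ∧
      LinearMap.det (L : Euc n →ₗ[ℝ] Euc n) = P.det := by
  have e : ∀ (P Q : Matrix (Fin n) (Fin n) ℝ), P * Q = 1 → ∀ x, Matrix.toEuclideanCLM (𝕜 := ℝ) P (Matrix.toEuclideanCLM (𝕜 := ℝ) Q x) = x := by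
    intro P Q h x
    have : Matrix.toEuclideanCLM (𝕜 := ℝ) (P * Q) x = x := by rw [h, map_one]; rfl
    rw [map_mul] at this
    exact this
  refine ⟨ContinuousLinearEquiv.equivOfInverse (Matrix.toEuclideanCLM (𝕜 := ℝ) P) (Matrix.toEuclideanCLM (𝕜 := ℝ) Q) (e Q P h2) (e P Q h1), ?_, ?_, ?_⟩
  · intro x i; rfl
  · intro x i; rfl
  · rw [← LinearMap.det_toLin (PiLp.basisFun 2 ℝ (Fin n)) P]
    congr 1

lemma form_eq {n : ℕ} (B : Matrix (Fin n) (Fin n) ℝ) (v : Fin n → ℝ) :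
    ∑ i, ∑ j, (B.transpose * B) i j * v i * v j = ∑ k, (B.mulVec v k) ^ 2 := by
  have : ∑ i, ∑ j, (B.transpose * B) i j * v i * v j = v ⬝ᵥ (B.transpose * B).mulVec v := by
    simp only [dotProduct, Matrix.mulVec, Finset.mul_sum]
    refine Finset.sum_congr rfl fun i _ => Finset.sum_congr rfl fun j _ => by ring
  rw [this, ← Matrix.mulVec_mulVec, Matrix.dotProduct_mulVec, Matrix.vecMul_transpose]
  simp only [dotProduct, sq]

lemma mulVec_sq_le {n : ℕ} (B : Matrix (Fin n) (Fin n) ℝ) : ∃ b > 0, ∀ v : Fin n → ℝ,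
    ∑ k, (B.mulVec v k) ^ 2 ≤ b ^ 2 * ∑ k, v k ^ 2 := by
  set S := ∑ k, ∑ i, B k i ^ 2
  have hS : 0 ≤ S := Finset.sum_nonneg fun k _ => Finset.sum_nonneg fun i _ => sq_nonneg _
  refine ⟨S + 1, by positivity, fun v => ?_⟩
  have h1 : ∑ k, (B.mulVec v k) ^ 2 ≤ S * ∑ k, v k ^ 2 := by
    rw [Finset.sum_mul]
    refine Finset.sum_le_sum fun k _ => ?_
    exact Finset.sum_mul_sq_le_sq_mul_sq Finset.univ (fun i => B k i) v
  refine h1.trans (mul_le_mul_of_nonneg_right (by nlinarith) (Finset.sum_nonneg fun k _ => sq_nonneg _))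

lemma form_lower {n : ℕ} {A : Matrix (Fin n) (Fin n) ℝ} (hA : A.PosDef) : ∃ κ > 0, ∀ v : Fin n → ℝ,
    ∑ i, v i ^ 2 ≤ κ * ∑ i, ∑ j, A i j * v i * v j := by
  obtain ⟨B, rfl, hB⟩ := fac hA
  obtain ⟨b, hb, h⟩ := mulVec_sq_le B⁻¹
  refine ⟨b ^ 2, by positivity, fun v => ?_⟩
  rw [form_eq]
  have := h (B.mulVec v)
  rwa [Matrix.mulVec_mulVec, Matrix.nonsing_inv_mul _ hB, Matrix.one_mulVec] at this

lemma form_nonneg {n : ℕ} {A : Matrix (Fin n) (Fin n) ℝ} (hA : A.PosDef) (v : Fin n → ℝ) :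
    0 ≤ ∑ i, ∑ j, A i j * v i * v j := by
  obtain ⟨B, rfl, hB⟩ := fac hA
  rw [form_eq]
  exact Finset.sum_nonneg fun k _ => sq_nonneg _

/-- the quadratic form of the gradient -/
def qB (n : ℕ) (A : Matrix (Fin n) (Fin n) ℝ) (f : Euc n × ℝ → ℝ) (X : Euc n × ℝ) : ℝ :=
  (∑ i, ∑ j, A i j * fderiv ℝ f X (EuclideanSpace.single i 1, 0) * fderiv ℝ f X (EuclideanSpace.single j 1, 0)) + (fderiv ℝ f X (0, 1)) ^ 2

lemma qB_nonneg {n : ℕ} {A : Matrix (Fin n) (Fin n) ℝ} (hA : A.PosDef) (f : Euc n × ℝ → ℝ) (X) : 0 ≤ qB n A f X :=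
  add_nonneg (form_nonneg hA _) (sq_nonneg _)

lemma qB_int {n : ℕ} {s : ℝ} (hs : s ∈ Ioo (0:ℝ) 1) (A : Matrix (Fin n) (Fin n) ℝ) {f : Euc n × ℝ → ℝ} (hf : Tst n f) :
    Integrable (qB n A f) (mu n s) := by
  have h := hf.cont_fderiv
  refine int_mu hs (by unfold qB; fun_prop) ((hf.2.fderiv ℝ).mono ?_)
  intro X hX hX'
  exact hX (by simp [qB, hX'])

lemma quadB_eq {n : ℕ} (A : Matrix (Fin n) (Fin n) ℝ) {f : Euc n × ℝ → ℝ} {w : Euc n → ℝ → ℝ} {x : Euc n} {y : ℝ}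
    (h : DifferentiableAt ℝ f (x, y)) (hw : (fun p : Euc n × ℝ => w p.1 p.2) = f) :
    quadB n A w x y = qB n A f (x, y) := by
  subst hw
  unfold quadB quadA qB
  simp only [pdX_eq h, pdY_eq h]

lemma transplant {n : ℕ} {s : ℝ} (hs : s ∈ Ioo (0:ℝ) 1) {A : Matrix (Fin n) (Fin n) ℝ} (hA : A.PosDef) :
    ∃ b > 0, ∀ (z : Euc n) (ε R : ℝ), 0 < ε → 0 < R → ∀ g, Tst n g → (∀ X, g X ≠ 0 → nq X ≤ R ^ 2) →
      ∃ f, Tst n f ∧ (∀ X, f X ≠ 0 → ‖X.1 - z‖ ≤ b * ε * R) ∧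
        ∫ X, qB n A f X ∂(mu n s) = ε ^ ((n:ℝ) - 2*s) * A.det ^ (1/2 : ℝ) * En n s g ∧
        ∀ F : ℝ → ℝ, ∫ x, F (f (x, 0)) = ε ^ (n:ℝ) * A.det ^ (1/2 : ℝ) * ∫ x, F (g (x, 0)) := by
  obtain ⟨B, rfl, hB⟩ := fac hA
  obtain ⟨b, hb, hbl⟩ := mulVec_sq_le B.transpose
  refine ⟨b, hb, fun z ε R hε hR g hg hsupp => ?_⟩
  have hε' : 0 < ε⁻¹ := by positivity
  have hBt : IsUnit B.transpose.det := by rwa [Matrix.det_transpose]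
  obtain ⟨L, hL, hLs, hLd⟩ := mkL (ε⁻¹ • (B.transpose)⁻¹) (ε • B.transpose)
    (by rw [Matrix.smul_mul, Matrix.mul_smul, smul_smul, inv_mul_cancel₀ hε.ne', one_smul, Matrix.nonsing_inv_mul _ hBt])
    (by rw [Matrix.smul_mul, Matrix.mul_smul, smul_smul, mul_inv_cancel₀ hε.ne', one_smul, Matrix.mul_nonsing_inv _ hBt])
  have hdet : (B.transpose * B).det ^ (1/2 : ℝ) = |B.det| := by
    rw [Matrix.det_mul, Matrix.det_transpose, ← Real.sqrt_eq_rpow, Real.sqrt_mul_self_eq_abs]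
  have hdL : |LinearMap.det (L : Euc n →ₗ[ℝ] Euc n)|⁻¹ = ε ^ n * |B.det| := by
    rw [hLd, Matrix.det_smul, Matrix.det_nonsing_inv, Matrix.det_transpose, Fintype.card_fin, Ring.inverse_eq_inv', abs_mul, abs_inv,
      abs_of_pos (by positivity), mul_inv, inv_pow, inv_inv, inv_inv]
  have hfT := hg.aff L (-L z) hε' 1
  refine ⟨_, hfT, ?_, ?_, ?_⟩
  · intro X hX
    rw [one_mul] at hX
    have h1 := hsupp _ hX
    rw [nq_eq] at h1
    simp only at h1
    have h2 : ‖L (X.1 - z)‖ ^ 2 ≤ R ^ 2 := by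
      rw [map_sub, sub_eq_add_neg]
      nlinarith [sq_nonneg (ε⁻¹ * X.2)]
    set w := L (X.1 - z) with hw
    have h3 : X.1 - z = L.symm w := by rw [hw, L.symm_apply_apply]
    rw [h3]
    refine abs_le_of_sq_le_sq' ?_ (by positivity) |>.2
    rw [EuclideanSpace.real_norm_sq_eq] at h2 ⊢
    simp only [hLs]
    have h4 := hbl w.ofLp
    simp only [Matrix.smul_mulVec, Pi.smul_apply, smul_eq_mul, mul_pow]
    rw [← Finset.mul_sum]
    have h5 := mul_le_mul_of_nonneg_left (h4.trans (mul_le_mul_of_nonneg_left h2 (sq_nonneg b))) (sq_nonneg ε)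
    linarith
  · have hq : ∀ X : Euc n × ℝ, qB n (B.transpose * B) (fun X => 1 * g (L X.1 + -L z, ε⁻¹ * X.2)) X = (ε⁻¹) ^ 2 * gsq n g (L X.1 + -L z, ε⁻¹ * X.2) := by
      intro X
      unfold qB gsq
      rw [form_eq]
      set l := fderiv ℝ g (L X.1 + -L z, ε⁻¹ * X.2) with hl
      set G : Fin n → ℝ := fun k => l (EuclideanSpace.single k 1, 0) with hG
      have hv : (fun i => fderiv ℝ (fun X => 1 * g (L X.1 + -L z, ε⁻¹ * X.2)) X (EuclideanSpace.single i 1, 0)) = ε⁻¹ • (B⁻¹).mulVec G := by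
        ext i
        rw [fderiv_aff hg L (-L z) ε⁻¹ 1, one_mul, lin_decomp]
        simp only [mul_zero, zero_mul, add_zero, hL, Pi.smul_apply, smul_eq_mul, Matrix.mulVec, dotProduct, Finset.mul_sum]
        refine Finset.sum_congr rfl fun k _ => ?_
        rw [← hl]
        simp only [Matrix.smul_apply, smul_eq_mul, ← Matrix.transpose_nonsing_inv, Matrix.transpose_apply]
        simp only [PiLp.single_apply, hG]
        simp
        ring
      rw [hv, Matrix.mulVec_smul, Matrix.mulVec_mulVec, Matrix.mul_nonsing_inv _ hB, Matrix.one_mulVec,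
        fderiv_aff hg L (-L z) ε⁻¹ 1, map_zero, mul_one, one_mul, ← hl]
      have : l ((0 : Euc n), ε⁻¹) = ε⁻¹ * l (0, 1) := by
        have : ((0 : Euc n), ε⁻¹) = ε⁻¹ • ((0 : Euc n), (1:ℝ)) := by simp
        rw [this, map_smul, smul_eq_mul]
      rw [this]
      simp only [Pi.smul_apply, smul_eq_mul, mul_pow, hG]
      rw [← Finset.mul_sum, mul_add]
    simp only [hq]
    rw [integral_const_mul, int_aff hs L (-L z) hε' hg.cont_gsq hg.supp_gsq, hdL, hdet, En]
    have : ε⁻¹ ^ 2 * (ε ^ n * |B.det| * (ε⁻¹ ^ (2 - 2*s))⁻¹ * ∫ X, gsq n g X ∂(mu n s)) =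
       (ε⁻¹ ^ 2 * ε ^ n * (ε⁻¹ ^ (2 - 2*s))⁻¹) * |B.det| * ∫ X, gsq n g X ∂(mu n s) := by ring
    rw [this]
    congr 2
    rw [Real.inv_rpow hε.le, inv_inv, inv_pow, ← Real.rpow_natCast ε 2, ← Real.rpow_natCast ε n, ← Real.rpow_neg hε.le, ← Real.rpow_add hε, ← Real.rpow_add hε]
    congr 1; push_cast; ring
  · intro F
    simp only [one_mul, mul_zero]
    rw [vol_aff L (-L z) (fun x => F (g (x, 0))), hdL, hdet, Real.rpow_natCast]

lemma energy_le {n : ℕ} {s : ℝ} (hs : s ∈ Ioo (0:ℝ) 1) {Ω : Set (Euc n)} (hΩ : IsOpen Ω)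
    {A : Euc n → Matrix (Fin n) (Fin n) ℝ} (hApos : ∀ x ∈ Ω, (A x).PosDef) {A₀ : Matrix (Fin n) (Fin n) ℝ} (hA₀ : A₀.PosDef)
    {f : Euc n × ℝ → ℝ} (hf : Tst n f) {z : Euc n} {ρ η : ℝ} (hη : 0 ≤ η) (hsupp : ∀ X, f X ≠ 0 → ‖X.1 - z‖ ≤ ρ)
    (hA : ∀ x ∈ Ω, ‖x - z‖ ≤ ρ → ∀ v : Fin n → ℝ, ∑ i, ∑ j, A x i j * v i * v j ≤ (1 + η) * ∑ i, ∑ j, A₀ i j * v i * v j) :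
    ∫ x in Ω, ∫ y in Ioi (0:ℝ), y ^ (1 - 2*s) * quadB n (A x) (fun x y => f (x, y)) x y ≤
      (1 + η) * ∫ X, qB n A₀ f X ∂(mu n s) := by
  have hI := qB_int hs A₀ hf
  have hpt : ∀ x ∈ Ω, ∀ y, qB n (A x) f (x, y) ≤ (1 + η) * qB n A₀ f (x, y) := by
    intro x hx y
    by_cases h : ‖x - z‖ ≤ ρ
    · have := hA x hx h (fun i => fderiv ℝ f (x, y) (EuclideanSpace.single i 1, 0))
      unfold qB
      rw [mul_add]
      refine add_le_add this ?_
      nlinarith [sq_nonneg (fderiv ℝ f (x, y) (0, 1))]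
    · have he : f =ᶠ[𝓝 (x, y)] (fun _ => 0) := by
        have : {X : Euc n × ℝ | ρ < ‖X.1 - z‖} ∈ 𝓝 (x, y) :=
          (isOpen_lt continuous_const (by fun_prop)).mem_nhds (not_le.1 h)
        filter_upwards [this] with X hX
        by_contra h0
        exact absurd (hsupp X h0) (not_le.2 hX)
      have hz : fderiv ℝ f (x, y) = 0 := by rw [he.fderiv_eq]; simp
      simp [qB, hz]
  have h1 : ∀ x, ∫ y in Ioi (0:ℝ), y ^ (1 - 2*s) * quadB n (A x) (fun x y => f (x, y)) x y = ∫ y, qB n (A x) f (x, y) ∂(wt s) := by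
    intro x
    rw [integral_wt]
    refine integral_congr_ae (Eventually.of_forall fun y => ?_)
    simp only
    rw [quadB_eq (A x) (hf.diff (x, y)) rfl]
  simp only [h1]
  unfold mu at hI ⊢
  rw [integral_prod _ hI, ← integral_const_mul]
  have hI2 : Integrable (fun x => (1 + η) * ∫ y, qB n A₀ f (x, y) ∂(wt s)) := hI.integral_prod_left.const_mul _
  calc _ ≤ ∫ x in Ω, (1 + η) * ∫ y, qB n A₀ f (x, y) ∂(wt s) := by
        refine integral_mono_of_nonneg ?_ hI2.integrableOn ?_
        · refine ae_restrict_of_forall_mem hΩ.measurableSet fun x hx => ?_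
          exact integral_nonneg fun y => qB_nonneg (hApos x hx) f _
        · filter_upwards [ae_restrict_mem hΩ.measurableSet, ae_restrict_of_ae hI.prod_right_ae] with x hx hxi
          rw [← integral_const_mul]
          exact integral_mono_of_nonneg (Eventually.of_forall fun y => qB_nonneg (hApos x hx) f _) (hxi.const_mul _)
            (Eventually.of_forall fun y => hpt x hx y)
    _ ≤ _ := by
        refine setIntegral_le_integral hI2 (Eventually.of_forall fun x => ?_)
        exact mul_nonneg (by linarith) (integral_nonneg fun y => qB_nonneg hA₀ f _)

lemma S_bdd {n : ℕ} (hn : 1 ≤ n) {s : ℝ} (hs : s ∈ Ioo (0:ℝ) 1) (hns : 2 * s < (n:ℝ)) {cs lam : ℝ} (hcs : 0 < cs) (hlam : 0 < lam)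
    {Ω : Set (Euc n)} (hΩ : IsOpen Ω) (hΩb : Bornology.IsBounded Ω)
    {A : Euc n → Matrix (Fin n) (Fin n) ℝ} (hApos : ∀ x ∈ Ω, (A x).PosDef) : BddBelow (SQuotSet n s cs lam Ω A) := by
  refine ⟨-(lam * (volume.real Ω + 1)), ?_⟩
  rintro r ⟨f, hf, hc, hsub, ⟨x1, hx1⟩, rfl⟩
  obtain ⟨u, hu, hue⟩ := exists_tst hf hc
  have hux : ∀ x, f x 0 = u (x, 0) := fun x => (hue (x, 0) le_rfl).symm
  simp only [hux]
  have hn' : (1:ℝ) ≤ n := by exact_mod_cast hn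
  have hq := q_pos hn hns
  have hq2 := q_two hs hns
  have hmn : ((n:ℝ) - 2*s)/n = 2 / (2*(n:ℝ) / ((n:ℝ) - 2*s)) := by
    have : (n:ℝ) - 2*s ≠ 0 := by linarith
    have : (n:ℝ) ≠ 0 := by linarith
    field_simp
  have hout : ∀ x, x ∉ Ω → u (x, 0) = 0 := by
    intro x hx
    by_contra h
    exact hx (hsub (subset_closure (show (0:ℝ) ≤ ((x, (0:ℝ)) : Euc n × ℝ).2 ∧ f x 0 ≠ 0 from ⟨le_rfl, by rwa [hux]⟩))).1
  have hN : ∫ x in Ω, |u (x, 0)| ^ (2*(n:ℝ) / ((n:ℝ) - 2*s)) = NN n s u := by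
    refine setIntegral_eq_integral_of_forall_compl_eq_zero fun x hx => ?_
    rw [hout x hx, abs_zero, Real.zero_rpow hq.ne']
  have hNp : 0 < NN n s u := NN_pos hn hns hu (x := x1) (by rwa [← hux])
  rw [hN]
  rw [hmn]
  set q := 2*(n:ℝ) / ((n:ℝ) - 2*s) with hqd
  set N := NN n s u with hNd
  set κ := N ^ (1/q) with hκ
  have hκp : 0 < κ := by positivity
  have hκ2 : N ^ (2/q) = κ ^ 2 := by
    rw [hκ, ← Real.rpow_natCast, ← Real.rpow_mul hNp.le]; congr 1; push_cast; ring
  have hκq : κ ^ q = N := by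
    rw [hκ, ← Real.rpow_mul hNp.le, one_div_mul_cancel hq.ne', Real.rpow_one]
  have hE : 0 ≤ ∫ x in Ω, ∫ y in Ioi (0:ℝ), y ^ (1 - 2*s) * quadB n (A x) f x y := by
    refine setIntegral_nonneg hΩ.measurableSet fun x hx => setIntegral_nonneg measurableSet_Ioi fun y hy => ?_
    refine mul_nonneg (Real.rpow_nonneg (le_of_lt hy) _) (add_nonneg (form_nonneg (hApos x hx) _) (sq_nonneg _))
  have hvol : volume Ω ≠ ⊤ := hΩb.measure_lt_top.ne
  have hL : ∫ x in Ω, u (x, 0) ^ 2 ≤ κ ^ 2 * (volume.real Ω + 1) := by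
    have hintg : IntegrableOn (fun x => κ ^ 2 * (1 + N⁻¹ * |u (x, 0)| ^ q)) Ω :=
      ((integrableOn_const (hs := hvol)).add ((hu.tr_pow_int hq).integrableOn.const_mul _)).const_mul _
    calc _ ≤ ∫ x in Ω, κ ^ 2 * (1 + N⁻¹ * |u (x, 0)| ^ q) := by
          refine integral_mono_of_nonneg (Eventually.of_forall fun x => sq_nonneg _) hintg (Eventually.of_forall fun x => ?_)
          have := sq_le_one_add (t := |u (x,0)| / κ) (by positivity) hq2
          rw [Real.div_rpow (abs_nonneg _) hκp.le, hκq, div_pow, sq_abs, div_le_iff₀ (by positivity)] at this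
          simp only
          rw [inv_mul_eq_div]
          linarith
      _ = κ ^ 2 * (volume.real Ω + 1) := by
          have hci : Integrable (fun _ : Euc n => (1:ℝ)) (volume.restrict Ω) := integrableOn_const (hs := hvol)
          rw [integral_const_mul, integral_add hci ((hu.tr_pow_int hq).integrableOn.const_mul _),
            integral_const_mul, hN, inv_mul_cancel₀ hNp.ne']
          simp
  rw [hκ2, le_div_iff₀ (by positivity)]
  have h1 := mul_le_mul_of_nonneg_left hL hlam.le
  have h2 := mul_nonneg hcs.le hE
  nlinarith

lemma choose_k {N s σ α : ℝ} (hs : 0 < s) (hn4 : 4 * s < N) (hα1 : 1 ≤ α)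
    (hα2 : α < σ * (N - 4*s) / (2 * s * (N - 2*s))) :
    ∃ k > 0, 0 < σ - 2*s*(k+α) ∧ 0 < k*(N-4*s) - 2*s*α := by
  have h4 : 0 < N - 4*s := by linarith
  have h2 : 0 < N - 2*s := by linarith
  rw [lt_div_iff₀ (by positivity)] at hα2
  have : 2*s*α/(N-4*s) < (σ - 2*s*α)/(2*s) := by
    rw [div_lt_div_iff₀ h4 (by positivity)]
    nlinarith
  obtain ⟨k, hk1, hk2⟩ := exists_between this
  rw [div_lt_iff₀ h4] at hk1
  rw [lt_div_iff₀ (by positivity)] at hk2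
  refine ⟨k, ?_, by linarith, by linarith⟩
  have : 0 < 2*s*α := by positivity
  by_contra h
  have := mul_nonneg_of_nonpos_of_nonpos (not_lt.1 h) (by linarith : -(N-4*s) ≤ 0)
  linarith

lemma ev_scal {N s σ α k C1 C K cs lam c δ b r₀ r1 : ℝ} (hs : 0 < s) (hn4 : 4 * s < N) (hk : 0 < k)
    (hk1 : 0 < σ - 2*s*(k+α)) (hk2 : 0 < k*(N-4*s) - 2*s*α) (hC1 : 0 < C1) (hC : 0 < C) (hK : 0 ≤ K) (hcs : 0 < cs)
    (hlam : 0 < lam) (hc : 0 < c) (hδ : 0 < δ) (hb : 0 < b) (hr₀ : 0 < r₀) (hr1 : 0 < r1) :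
    ∀ᶠ d in 𝓝[>] (0:ℝ), cs * ((1 + C1 * d^σ) * (K + C * (d^k)^(N-2*s))) < cs * K + lam * (c * (d^k * (δ*d^α)/(2*b))^(2*s)) ∧
      d ≤ 1 ∧ (1+δ)*d < r₀ ∧ d^k ≤ r1 := by
  have t0 : Tendsto (fun d : ℝ => d) (𝓝[>] (0:ℝ)) (𝓝 0) := tendsto_id.mono_left nhdsWithin_le_nhds
  have tp : ∀ β : ℝ, 0 < β → Tendsto (fun d : ℝ => d ^ β) (𝓝[>] (0:ℝ)) (𝓝 0) := by
    intro β hβ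
    have := t0.rpow_const (p := β) (Or.inr hβ.le)
    rwa [Real.zero_rpow hβ.ne'] at this
  set T := (δ/(2*b))^(2*s) with hT
  have hTp : 0 < T := by positivity
  have e1 : ∀ᶠ d in 𝓝[>] (0:ℝ), cs * (C1 * (K + C) * d ^ (σ - 2*s*(k+α)) + C * d ^ (k*(N-4*s) - 2*s*α)) < lam * (c * T) := by
    have := (((tp _ hk1).const_mul (C1 * (K + C))).add ((tp _ hk2).const_mul C)).const_mul cs
    simp only [mul_zero, add_zero] at this
    exact this.eventually (gt_mem_nhds (by positivity))
  have e2 : ∀ᶠ d in 𝓝[>] (0:ℝ), d < 1 := t0.eventually (gt_mem_nhds one_pos)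
  have e3 : ∀ᶠ d in 𝓝[>] (0:ℝ), (1+δ)*d < r₀ := by
    have := t0.const_mul (1+δ)
    rw [mul_zero] at this
    exact this.eventually (gt_mem_nhds hr₀)
  have e4 : ∀ᶠ d in 𝓝[>] (0:ℝ), d^k < r1 := (tp k hk).eventually (gt_mem_nhds hr1)
  filter_upwards [e1, e2, e3, e4, self_mem_nhdsWithin] with d h1 h2 h3 h4 hd
  have hd : 0 < d := hd
  refine ⟨?_, h2.le, h3, h4.le⟩
  have a1 : (d^k * (δ*d^α)/(2*b))^(2*s) = T * d^(2*s*(k+α)) := by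
    have : d^k * (δ*d^α)/(2*b) = (δ/(2*b)) * d^(k+α) := by rw [Real.rpow_add hd]; ring
    rw [this, Real.mul_rpow (by positivity) (by positivity), ← Real.rpow_mul hd.le]
    congr 2; ring
  have a2 : (d^k)^(N-2*s) = d^(2*s*(k+α)) * d^(k*(N-4*s) - 2*s*α) := by
    rw [← Real.rpow_mul hd.le, ← Real.rpow_add hd]; congr 1; ring
  have a3 : d^σ = d^(2*s*(k+α)) * d^(σ - 2*s*(k+α)) := by
    rw [← Real.rpow_add hd]; congr 1; ring
  have a4 : (d^k)^(N-2*s) ≤ 1 := Real.rpow_le_one (by positivity) (Real.rpow_le_one hd.le h2.le hk.le) (by linarith)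
  set G := d^(2*s*(k+α))
  have hG : 0 < G := by positivity
  set P := d^(σ - 2*s*(k+α))
  have hP : 0 < P := by positivity
  set Q := d^(k*(N-4*s) - 2*s*α)
  have h5 := mul_lt_mul_of_pos_left h1 hG
  rw [a1, a2, a3]
  rw [a2] at a4
  have h6 : cs * (C1 * (G * P) * C) * (G * Q) ≤ cs * (C1 * (G * P) * C) * 1 := mul_le_mul_of_nonneg_left a4 (by positivity)
  nlinarith

set_option maxHeartbeats 1000000

/-- The key strict energy estimate in the boundary case (Section 4). -/
theorem boundary_energy_estimate
    (n : ℕ) (hn : 1 ≤ n) (s : ℝ) (hs : s ∈ Ioo (0:ℝ) 1) (hns : 2 * s < (n:ℝ))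
    (cs : ℝ) (hcs : 0 < cs)
    (Ω : Set (Euc n)) (hΩo : IsOpen Ω) (hΩb : Bornology.IsBounded Ω)
    (A : Euc n → Matrix (Fin n) (Fin n) ℝ)
    (hAc : ∀ i j, ContinuousOn (fun x => A x i j) (closure Ω))
    (hAsym : ∀ x ∈ closure Ω, (A x).IsSymm)
    (hApos : ∀ x ∈ closure Ω, (A x).PosDef)
    (x₀ : Euc n) (hx₀ : x₀ ∈ frontier Ω)
    (C₀ σ r₀ : ℝ) (hC₀ : 0 < C₀)
    (hσ : 2 * s * ((n:ℝ) - 2*s) / ((n:ℝ) - 4*s) < σ) (hr₀ : 0 < r₀)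
    (hA_ub : ∀ x ∈ closure Ω, ‖x - x₀‖ < r₀ → ∀ v : Euc n,
      (∑ i, ∑ j, A x i j * v i * v j)
        ≤ (∑ i, ∑ j, A x₀ i j * v i * v j) + C₀ * ‖x - x₀‖ ^ σ * ‖v‖ ^ 2)
    (α : ℝ) (hα1 : 1 ≤ α) (hα2 : α < σ * ((n:ℝ) - 4*s) / (2 * s * ((n:ℝ) - 2*s)))
    (hsing : AlphaSingular n Ω x₀ α)
    (hn4 : 4 * s < (n:ℝ))
    (lam : ℝ) (hlam : 0 < lam) :
    sInf (SQuotSet n s cs lam Ω A)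
      < cs * (A x₀).det ^ (s / (n:ℝ)) * sInf (KQuotSet n s) := by
  have hs0 := hs.1
  have hn' : (1:ℝ) ≤ n := by exact_mod_cast hn
  have hσ0 : 0 < σ := by
    refine lt_trans (div_pos (mul_pos (by linarith) (by linarith)) (by linarith)) hσ
  have hx₀c : x₀ ∈ closure Ω := frontier_subset_closure hx₀
  have hx₀n : x₀ ∉ Ω := by
    rw [hΩo.frontier_eq] at hx₀
    exact hx₀.2
  have hA₀ := hApos x₀ hx₀c
  have hAΩ : ∀ x ∈ Ω, (A x).PosDef := fun x hx => hApos x (subset_closure hx)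
  obtain ⟨κ, hκ, hform⟩ := form_lower hA₀
  obtain ⟨b, hb, htr⟩ := transplant hs hA₀
  obtain ⟨C, hC, c, hc, r1, hr1, hP⟩ := propP hn hs hns
  obtain ⟨δ, hδ, xs, hxs, hxt, hball⟩ := hsing
  obtain ⟨k, hk, hk1, hk2⟩ := choose_k hs0 hn4 hα1 hα2
  have hK := K_nonneg n s
  set K := sInf (KQuotSet n s) with hKd
  set C1 := C₀ * κ * (1 + δ) ^ σ with hC1d
  have hC1 : 0 < C1 := by positivity
  have hdt : Tendsto (fun j => ‖xs j - x₀‖) atTop (𝓝[>] (0:ℝ)) := by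
    refine tendsto_nhdsWithin_iff.2 ⟨?_, Eventually.of_forall fun j => ?_⟩
    · have := (hxt.sub_const x₀).norm
      simpa using this
    · refine norm_pos_iff.2 (sub_ne_zero.2 fun h => hx₀n (h ▸ hxs j))
  obtain ⟨j, ⟨hsc, hd1, hdr, hdk⟩, hdpos⟩ := ((hdt.eventually (ev_scal hs0 hn4 hk hk1 hk2 hC1 hC hK hcs hlam hc hδ hb hr₀ hr1)).and
    (hdt.eventually self_mem_nhdsWithin)).exists
  have hballj := hball j
  have hzΩ := hxs j
  set z := xs j
  set d := ‖z - x₀‖ with hdd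
  have hdpos : 0 < d := hdpos
  set r := d ^ k with hr
  have hrp : 0 < r := by positivity
  set ρ := δ * d ^ α with hρ
  have hρp : 0 < ρ := by positivity
  set ε := r * ρ / (2*b) with hε
  have hεp : 0 < ε := by positivity
  obtain ⟨g, hg, hgs, hgN, hgE, hgL⟩ := hP r hrp hdk
  obtain ⟨f, hf, hfs, hfE, hfF⟩ := htr z ε r⁻¹ hεp (by positivity) g hg hgs
  have hbR : b * ε * r⁻¹ = ρ / 2 := by rw [hε]; field_simp
  rw [hbR] at hfs
  have hcb : ∀ x, ‖x - z‖ ≤ ρ / 2 → x ∈ Ω := fun x hx => hballj (by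
    rw [mem_ball_iff_norm]; linarith)
  have hρd : ρ ≤ δ * d := by
    refine mul_le_mul_of_nonneg_left ?_ hδ.le
    have := Real.rpow_le_rpow_of_exponent_ge hdpos hd1 hα1
    rwa [Real.rpow_one] at this
  have hη : 0 ≤ C1 * d ^ σ := by positivity
  have hAle : ∀ x ∈ Ω, ‖x - z‖ ≤ ρ / 2 → ∀ v : Fin n → ℝ,
      ∑ i, ∑ j, A x i j * v i * v j ≤ (1 + C1 * d ^ σ) * ∑ i, ∑ j, A x₀ i j * v i * v j := by
    intro x hx hxz v
    have hxd : ‖x - x₀‖ ≤ (1 + δ) * d := by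
      have : x - x₀ = (x - z) + (z - x₀) := by abel
      rw [this]
      refine (norm_add_le _ _).trans ?_
      rw [← hdd]
      linarith
    have h1 := hA_ub x (subset_closure hx) (hxd.trans_lt hdr) (WithLp.toLp 2 v)
    rw [EuclideanSpace.real_norm_sq_eq] at h1
    simp only at h1
    have h2 : ‖x - x₀‖ ^ σ ≤ (1 + δ) ^ σ * d ^ σ := by
      rw [← Real.mul_rpow (by positivity) hdpos.le]
      exact Real.rpow_le_rpow (norm_nonneg _) hxd hσ0.le
    have h3 := hform v
    have h4 : C₀ * ‖x - x₀‖ ^ σ * ∑ i, v i ^ 2 ≤ C₀ * ((1 + δ) ^ σ * d ^ σ) * (κ * ∑ i, ∑ j, A x₀ i j * v i * v j) :=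
      mul_le_mul (mul_le_mul_of_nonneg_left h2 hC₀.le) h3 (Finset.sum_nonneg fun i _ => sq_nonneg _) (by positivity)
    rw [hC1d]
    linarith
  have hEle := energy_le hs hΩo hAΩ hA₀ hf hη hfs hAle
  rw [hfE] at hEle
  have hq := q_pos hn hns
  have hout : ∀ x, x ∉ Ω → f (x, 0) = 0 := by
    intro x hx
    by_contra h
    exact hx (hcb x (hfs (x, 0) h))
  have hNf : ∫ x in Ω, |f (x, 0)| ^ (2*(n:ℝ) / ((n:ℝ) - 2*s)) = ε ^ (n:ℝ) * (A x₀).det ^ (1/2 : ℝ) * NN n s g := by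
    rw [setIntegral_eq_integral_of_forall_compl_eq_zero fun x hx => by rw [hout x hx, abs_zero, Real.zero_rpow hq.ne']]
    exact hfF (fun t => |t| ^ (2*(n:ℝ) / ((n:ℝ) - 2*s)))
  have hLf : ∫ x in Ω, f (x, 0) ^ 2 = ε ^ (n:ℝ) * (A x₀).det ^ (1/2 : ℝ) * ∫ x : Euc n, g (x, 0) ^ 2 := by
    rw [setIntegral_eq_integral_of_forall_compl_eq_zero fun x hx => by rw [hout x hx]; norm_num]
    exact hfF (fun t => t ^ 2)
  have hD : 0 < (A x₀).det := hA₀.det_pos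
  have hclsub : closure {p : Euc n × ℝ | 0 ≤ p.2 ∧ f (p.1, p.2) ≠ 0} ⊆ Ω ×ˢ Ici (0:ℝ) := by
    have hcl : IsClosed {p : Euc n × ℝ | ‖p.1 - z‖ ≤ ρ / 2 ∧ 0 ≤ p.2} := by
      have c1 : Continuous fun p : Euc n × ℝ => ‖p.1 - z‖ := by fun_prop
      exact (isClosed_le c1 continuous_const).inter (isClosed_le continuous_const continuous_snd)
    refine (closure_minimal ?_ hcl).trans ?_
    · rintro p ⟨hp1, hp2⟩
      exact ⟨hfs (p.1, p.2) hp2, hp1⟩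
    · rintro p ⟨hp1, hp2⟩
      exact ⟨hcb _ hp1, hp2⟩
  have hclc : IsCompact (closure {p : Euc n × ℝ | 0 ≤ p.2 ∧ f (p.1, p.2) ≠ 0}) := by
    refine hf.2.isCompact.of_isClosed_subset isClosed_closure (closure_mono ?_)
    rintro p ⟨-, hp⟩
    exact hp
  have hnz : ∃ x, f (x, 0) ≠ 0 := by
    by_contra! h
    have : ∫ x in Ω, |f (x, 0)| ^ (2*(n:ℝ) / ((n:ℝ) - 2*s)) = 0 := by
      simp only [h, abs_zero, Real.zero_rpow hq.ne', integral_zero]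
    rw [hNf] at this
    have h2 : 0 < ε ^ (n:ℝ) * (A x₀).det ^ (1/2 : ℝ) * NN n s g := by positivity
    linarith
  have hmem := (show _ ∈ SQuotSet n s cs lam Ω A from ⟨fun x y => f (x, y), hf.1, hclc, hclsub, hnz, rfl⟩)
  refine (csInf_le (S_bdd hn hs hns hcs hlam hΩo hΩb hAΩ) hmem).trans_lt ?_
  rw [hNf, hLf]
  have hne : (n:ℝ) ≠ 0 := by linarith
  set D := (A x₀).det with hDd
  set M := NN n s g ^ (((n:ℝ) - 2*s) / (n:ℝ)) with hM
  have hMp : 0 < M := by positivity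
  have hden : (ε ^ (n:ℝ) * D ^ (1/2 : ℝ) * NN n s g) ^ (((n:ℝ) - 2*s) / (n:ℝ)) = ε ^ ((n:ℝ) - 2*s) * D ^ (1/2 - s/(n:ℝ)) * M := by
    rw [Real.mul_rpow (by positivity) hgN.le, Real.mul_rpow (by positivity) (by positivity), ← Real.rpow_mul hεp.le, ← Real.rpow_mul hD.le]
    congr 3
    · field_simp
    · field_simp
  rw [hden, div_lt_iff₀ (by positivity)]
  have hDD : D ^ (s / (n:ℝ)) * D ^ (1/2 - s/(n:ℝ)) = D ^ (1/2 : ℝ) := by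
    rw [← Real.rpow_add hD]; congr 1; ring
  have hεε : ε ^ (n:ℝ) = ε ^ ((n:ℝ) - 2*s) * ε ^ (2*s) := by
    rw [← Real.rpow_add hεp]; congr 1; ring
  have hrhs : cs * D ^ (s / (n:ℝ)) * K * (ε ^ ((n:ℝ) - 2*s) * D ^ (1/2 - s/(n:ℝ)) * M) = ε ^ ((n:ℝ) - 2*s) * D ^ (1/2 : ℝ) * M * (cs * K) := by
    rw [← hDD]; ring
  rw [hrhs]
  set W := ε ^ ((n:ℝ) - 2*s) * D ^ (1/2 : ℝ) with hW
  have hWp : 0 < W := by positivity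
  have i1 : cs * (∫ x in Ω, ∫ y in Ioi (0:ℝ), y ^ (1 - 2*s) * quadB n (A x) (fun x y => f (x, y)) x y) ≤
      cs * ((1 + C1 * d ^ σ) * (W * ((K + C * r ^ ((n:ℝ) - 2*s)) * M))) := by
    refine mul_le_mul_of_nonneg_left (hEle.trans ?_) hcs.le
    exact mul_le_mul_of_nonneg_left (mul_le_mul_of_nonneg_left hgE hWp.le) (by positivity)
  have i2 : lam * (W * ε ^ (2*s) * (c * M)) ≤ lam * (ε ^ (n:ℝ) * D ^ (1/2 : ℝ) * ∫ x : Euc n, g (x, 0) ^ 2) := by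
    refine mul_le_mul_of_nonneg_left ?_ hlam.le
    have : ε ^ (n:ℝ) * D ^ (1/2 : ℝ) = W * ε ^ (2*s) := by rw [hεε, hW]; ring
    rw [this]
    exact mul_le_mul_of_nonneg_left hgL (by positivity)
  have i3 := mul_lt_mul_of_pos_left hsc (mul_pos hWp hMp)
  linarith
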